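/- Let 1 < q < 2, α, μ > 0 and φ, φ̃ ∈ L¹(ℝ) with φ(x) ≤ φ̃(x) for a.e. x ∈ ℝ, and let u, ũ be classical solutions of the regularized problem with initial data φ, φ̃ respectively. Then u(t,x) ≤ ũ(t,x) for every t > 0 and a.e. x ∈ ℝ. -/

import Mathlib

open MeasureTheory Filter

/-- `u` is a classical solution of the regularized problem
`u_t + |u|^{q-1} u_x = α (J ∗ u - u) + μ u_xx` with initial datum `φ ∈ L¹(ℝ)`. -/
def IsRegSol (J : ℝ → ℝ) (q α μ : ℝ) (φ : ℝ → ℝ) (u : ℝ → ℝ → ℝ) : Prop :=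
  (∀ t : ℝ, 0 ≤ t → Integrable (u t)) ∧
  (∀ t₀ : ℝ, 0 ≤ t₀ →
    Tendsto (fun t => ∫ x, |u t x - u t₀ x|) (nhdsWithin t₀ (Set.Ici 0)) (nhds 0)) ∧
  (∀ t : ℝ, 0 < t → ContDiff ℝ 2 (u t)) ∧
  (∀ x : ℝ, ContDiffOn ℝ 1 (fun s => u s x) (Set.Ioi 0)) ∧
  (∀ t : ℝ, 0 < t → ∀ x : ℝ,
    deriv (fun s => u s x) t + |u t x| ^ (q - 1) * deriv (u t) x
      = α * ((∫ y, J (x - y) * u t y) - u t x) + μ * deriv (deriv (u t)) x) ∧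
  (u 0 =ᵐ[volume] φ)

namespace RegSol
open Set Topology

/-- Gaps of a set `T` of times. -/
def Gap (T : Set ℝ) : Set (ℝ × ℝ) :=
  {p | p.1 ∈ T ∧ p.2 ∈ T ∧ p.1 < p.2 ∧ ∀ x ∈ Ioo p.1 p.2, x ∉ T}

lemma gap_eq {T : Set ℝ} {p r : ℝ × ℝ} (hp : p ∈ Gap T) (hr : r ∈ Gap T) {x : ℝ}
    (hx : x ∈ Ioo p.1 p.2) (hx' : x ∈ Ioo r.1 r.2) : p = r := by
  obtain ⟨p1, p2, p3, p4⟩ := hp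
  obtain ⟨r1, r2, r3, r4⟩ := hr
  have h1 : p.1 = r.1 := by
    rcases lt_trichotomy p.1 r.1 with h | h | h
    · exact absurd r1 (p4 _ ⟨h, hx'.1.trans hx.2⟩)
    · exact h
    · exact absurd p1 (r4 _ ⟨h, hx.1.trans hx'.2⟩)
  have h2 : p.2 = r.2 := by
    rcases lt_trichotomy p.2 r.2 with h | h | h
    · exact absurd p2 (r4 _ ⟨hx'.1.trans hx.2, h⟩)
    · exact h
    · exact absurd r2 (p4 _ ⟨hx.1.trans hx'.2, h⟩)
  exact Prod.ext h1 h2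

lemma gap_disj (T : Set ℝ) :
    Pairwise (Function.onFun Disjoint (fun p : Gap T => Ioo p.1.1 p.1.2)) := by
  intro p r hpr
  rw [Function.onFun, Set.disjoint_left]
  intro x hx hx'
  exact hpr (Subtype.ext (gap_eq p.2 r.2 hx hx'))

lemma gap_countable (T : Set ℝ) : Countable (Gap T) := by
  have : (Gap T).Countable := by
    apply Set.PairwiseDisjoint.countable_of_isOpen (s := fun p : ℝ × ℝ => Ioo p.1 p.2)
    · intro p hp r hr hpr
      rw [Function.onFun, Set.disjoint_left]
      intro x hx hx'
      exact hpr (gap_eq hp hr hx hx')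
    · intro p _; exact isOpen_Ioo
    · intro p hp; exact nonempty_Ioo.2 hp.2.2.1
  exact this.to_subtype

lemma gap_union {T : Set ℝ} (hT : IsCompact T) {c d : ℝ} (hc : c ∈ T) (hd : d ∈ T)
    (hsub : T ⊆ Icc c d) : (⋃ p : Gap T, Ioo p.1.1 p.1.2) = Icc c d \ T := by
  ext x
  simp only [mem_iUnion, Set.mem_sdiff]
  constructor
  · rintro ⟨p, hp⟩
    exact ⟨⟨(hsub p.2.1).1.trans hp.1.le, hp.2.le.trans (hsub p.2.2.1).2⟩, p.2.2.2.2 x hp⟩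
  · rintro ⟨hx, hxT⟩
    have hA : IsCompact (T ∩ Iic x) := hT.inter_right isClosed_Iic
    have hB : IsCompact (T ∩ Ici x) := hT.inter_right isClosed_Ici
    obtain ⟨a, ha, ha'⟩ := hA.exists_isGreatest ⟨c, hc, hx.1⟩
    obtain ⟨b, hb, hb'⟩ := hB.exists_isLeast ⟨d, hd, hx.2⟩
    have hax : a < x := lt_of_le_of_ne ha.2 (fun h => hxT (h ▸ ha.1))
    have hxb : x < b := lt_of_le_of_ne hb.2 (fun h => hxT (h ▸ hb.1))
    refine ⟨⟨(a, b), ha.1, hb.1, hax.trans hxb, ?_⟩, hax, hxb⟩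
    intro y hy hyT
    rcases le_total y x with h | h
    · exact absurd (ha' ⟨hyT, h⟩) (not_le.2 hy.1)
    · exact absurd (hb' ⟨hyT, h⟩) (not_le.2 hy.2)

lemma gap_hasSum {T : Set ℝ} (hT : IsCompact T) {c d : ℝ} (hc : c ∈ T) (hd : d ∈ T)
    (hsub : T ⊆ Icc c d) {f f' : ℝ → ℝ} (hf : ∀ s ∈ Icc c d, HasDerivAt f (f' s) s)
    (hf' : ContinuousOn f' (Icc c d)) :
    HasSum (fun p : Gap T => f p.1.2 - f p.1.1) (f d - f c - ∫ s in T, f' s) := by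
  have := gap_countable T
  have hcd : c ≤ d := (hsub hc).2
  have hfInt : IntegrableOn f' (Icc c d) := hf'.integrableOn_Icc
  have key : ∀ a b, a ≤ b → Icc a b ⊆ Icc c d → ∫ s in Ioo a b, f' s = f b - f a := by
    intro a b hab hs
    rw [← integral_Ioc_eq_integral_Ioo, ← intervalIntegral.integral_of_le hab]
    apply intervalIntegral.integral_eq_sub_of_hasDerivAt
    · intro x hx
      rw [uIcc_of_le hab] at hx
      exact hf x (hs hx)
    · rw [intervalIntegrable_iff_integrableOn_Icc_of_le hab]
      exact hfInt.mono_set hs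
  have h1 := hasSum_integral_iUnion (μ := volume) (f := f') (s := fun p : Gap T => Ioo p.1.1 p.1.2)
    (fun p => measurableSet_Ioo) (gap_disj T)
    (by rw [gap_union hT hc hd hsub]; exact hfInt.mono_set sdiff_subset)
  rw [gap_union hT hc hd hsub, setIntegral_sdiff hT.measurableSet hfInt hsub,
    integral_Icc_eq_integral_Ioo, key c d hcd le_rfl] at h1
  have h2 : (fun p : Gap T => f p.1.2 - f p.1.1) = fun p : Gap T => ∫ s in Ioo p.1.1 p.1.2, f' s := by
    funext p
    exact (key _ _ p.2.2.2.1.le (Icc_subset_Icc (hsub p.2.1).1 (hsub p.2.2.1).2)).symm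
  rw [h2]
  exact h1

/-- Admissible functionals. -/
structure Cls (e : ℝ → ℝ → ℝ → ℝ) (k : ℝ → ℝ → ℝ) (R s1 s2 H : ℝ) (b db : ℝ → ℝ → ℝ) : Prop where
  hd : ∀ s, 0 < s → ∀ x, HasDerivAt (fun r => b r x) (db s x) s
  hc : ∀ x, ContinuousOn (fun s => db s x) (Ioi 0)
  hx : ∀ s, 0 < s → Continuous (b s)
  lip : ∃ C, 0 ≤ C ∧ (∀ s ∈ Icc s1 s2, ∀ t ∈ Icc s1 s2, ∀ x ∈ Icc (-R) R,
      |b s x - b t x| ≤ C * (e s t x + |s - t|)) ∧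
      (∀ s ∈ Icc s1 s2, ∀ x ∈ Icc (-R) R, |db s x| ≤ C * (k s x + 1))
  row : ∀ s ∈ Icc s1 s2, ∫ x in Icc (-R) R, db s x ≤ H

lemma Cls.mono {e k R s1 s2 H b db} (h : Cls e k R s1 s2 H b db) {t1 t2 : ℝ}
    (hs : Icc t1 t2 ⊆ Icc s1 s2) : Cls e k R t1 t2 H b db where
  hd := h.hd
  hc := h.hc
  hx := h.hx
  lip := by
    obtain ⟨C, h0, h1, h2⟩ := h.lip
    exact ⟨C, h0, fun s hs' t ht => h1 s (hs hs') t (hs ht), fun s hs' => h2 s (hs hs')⟩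
  row := fun s hs' => h.row s (hs hs')

def PP (e : ℝ → ℝ → ℝ → ℝ) (k : ℝ → ℝ → ℝ) (R s1 s2 : ℝ) : Prop :=
  ∀ b db H, Cls e k R s1 s2 H b db →
    ∫ x in Icc (-R) R, b s2 x ≤ (∫ x in Icc (-R) R, b s1 x) + H * (s2 - s1)

lemma PP.trans {e k R s1 s2 s3} (h12 : s1 ≤ s2) (h23 : s2 ≤ s3) (h : PP e k R s1 s2)
    (h' : PP e k R s2 s3) : PP e k R s1 s3 := by
  intro b db H hb
  have a1 := h b db H (hb.mono (Icc_subset_Icc le_rfl h23))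
  have a2 := h' b db H (hb.mono (Icc_subset_Icc h12 le_rfl))
  linarith

lemma PP.refl {e k R s} : PP e k R s s := by
  intro b db H _
  simp

/-- joint measurability of the time derivative -/
lemma meas_db {b db : ℝ → ℝ → ℝ} (hd : ∀ s, 0 < s → ∀ x, HasDerivAt (fun r => b r x) (db s x) s)
    (hx : ∀ s, 0 < s → Continuous (b s)) :
    Measurable (fun p : ℝ × ℝ => (Ioi (0:ℝ)).indicator (fun s => db s p.2) p.1) := by
  have hm : ∀ ε : ℝ, 0 ≤ ε → Measurable (fun p : ℝ × ℝ =>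
      (Ioi (0:ℝ)).indicator (fun s => b (s + ε) p.2) p.1) := by
    intro ε hε
    have : Measurable (Function.uncurry (fun (x s : ℝ) =>
        (Ioi (0:ℝ)).indicator (fun s => b (s + ε) x) s)) := by
      apply measurable_uncurry_of_continuous_of_measurable
      · intro s
        by_cases hs : s ∈ Ioi (0:ℝ)
        · simp only [indicator_of_mem hs]
          exact hx _ (by have : 0 < s := hs
                         linarith)
        · simp only [indicator_of_notMem hs]
          exact continuous_const
      · intro x
        have hco : ContinuousOn (fun s => b (s + ε) x) (Ioi 0) := by
          intro s hs
          have hs : 0 < s := hs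
          have := (hd (s + ε) (by linarith) x).continuousAt
          have h2 : ContinuousAt (fun s => b (s + ε) x) s :=
            ContinuousAt.comp (f := fun s => s + ε) (g := fun r => b r x) this (by fun_prop)
          exact h2.continuousWithinAt
        classical
        rw [← Set.piecewise_eq_indicator]
        exact hco.measurable_piecewise continuous_zero.continuousOn measurableSet_Ioi
    exact this.comp measurable_swap
  have hlim : Tendsto (fun (n : ℕ) => fun p : ℝ × ℝ =>
      ((n:ℝ) + 1) * ((Ioi (0:ℝ)).indicator (fun s => b (s + 1 / ((n:ℝ) + 1)) p.2) p.1
        - (Ioi (0:ℝ)).indicator (fun s => b (s + 0) p.2) p.1)) atTop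
      (𝓝 (fun p : ℝ × ℝ => (Ioi (0:ℝ)).indicator (fun s => db s p.2) p.1)) := by
    rw [tendsto_pi_nhds]
    rintro ⟨s, x⟩
    by_cases hs : s ∈ Ioi (0:ℝ)
    · simp only [indicator_of_mem hs]
      have h := (hd s hs x).tendsto_slope_zero
      have h2 : Tendsto (fun n : ℕ => 1 / ((n:ℝ) + 1)) atTop (𝓝[≠] 0) := by
        rw [tendsto_nhdsWithin_iff]
        refine ⟨tendsto_one_div_add_atTop_nhds_zero_nat, Eventually.of_forall fun n => ?_⟩
        simp only [mem_compl_iff, mem_singleton_iff]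
        positivity
      have h3 := h.comp h2
      refine h3.congr (fun n => ?_)
      simp
    · simp only [indicator_of_notMem hs]
      simp
  refine measurable_of_tendsto_metrizable (fun n => ?_) hlim
  exact ((hm _ (by positivity)).sub (hm 0 le_rfl)).const_mul _

end RegSol

namespace RegSol
open Set Topology

structure Setup (e : ℝ → ℝ → ℝ → ℝ) (R τ1 τ2 : ℝ) : Prop where
  pos : 0 < τ1
  e0 : ∀ s t x, 0 ≤ e s t x
  ei : ∀ s ∈ Icc τ1 τ2, ∀ t ∈ Icc τ1 τ2, IntegrableOn (e s t) (Icc (-R) R)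
  ec : ∀ t ∈ Icc τ1 τ2, Tendsto (fun s => ∫ x in Icc (-R) R, e s t x) (𝓝[Icc τ1 τ2] t) (𝓝 0)

lemma Setup.bint {e R τ1 τ2} (S : Setup e R τ1 τ2) {k s1 s2 H b db} (hb : Cls e k R s1 s2 H b db)
    {s : ℝ} (hs : s ∈ Icc τ1 τ2) : IntegrableOn (b s) (Icc (-R) R) :=
  (hb.hx s (S.pos.trans_le hs.1)).continuousOn.integrableOn_Icc

lemma Setup.diff {e R τ1 τ2} (S : Setup e R τ1 τ2) {k s1 s2 H b db}
    (hsub : Icc s1 s2 ⊆ Icc τ1 τ2) (hb : Cls e k R s1 s2 H b db) :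
    ∃ C, 0 ≤ C ∧ ∀ s ∈ Icc s1 s2, ∀ t ∈ Icc s1 s2, ∫ x in Icc (-R) R, |b s x - b t x| ≤
      C * ((∫ x in Icc (-R) R, e s t x) + volume.real (Icc (-R) R) * |s - t|) := by
  obtain ⟨C, hC, h1, -⟩ := hb.lip
  refine ⟨C, hC, fun s hs t ht => ?_⟩
  have hi : IntegrableOn (fun x => C * (e s t x + |s - t|)) (Icc (-R) R) := by
    apply Integrable.const_mul
    exact (S.ei s (hsub hs) t (hsub ht)).add (integrableOn_const (by simp))
  calc ∫ x in Icc (-R) R, |b s x - b t x| ≤ ∫ x in Icc (-R) R, C * (e s t x + |s - t|) := by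
        apply setIntegral_mono_on _ hi measurableSet_Icc (fun x hx => h1 s hs t ht x hx)
        exact ((S.bint hb (hsub hs)).sub (S.bint hb (hsub ht))).abs
    _ = _ := by
        rw [integral_const_mul, integral_add (S.ei s (hsub hs) t (hsub ht))
          (integrableOn_const (by simp))]
        simp

lemma Setup.cont {e R τ1 τ2} (S : Setup e R τ1 τ2) {k s1 s2 H b db}
    (hsub : Icc s1 s2 ⊆ Icc τ1 τ2) (hb : Cls e k R s1 s2 H b db) :
    ContinuousOn (fun s => ∫ x in Icc (-R) R, b s x) (Icc s1 s2) := by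
  obtain ⟨C, hC, h1⟩ := S.diff hsub hb
  intro t ht
  have h2 : Tendsto (fun s => C * ((∫ x in Icc (-R) R, e s t x) + volume.real (Icc (-R) R) * |s - t|))
      (𝓝[Icc s1 s2] t) (𝓝 0) := by
    have a := (S.ec t (hsub ht)).mono_left (nhdsWithin_mono t hsub)
    have b : Tendsto (fun s => volume.real (Icc (-R) R) * |s - t|) (𝓝[Icc s1 s2] t)
        (𝓝 (volume.real (Icc (-R) R) * |t - t|)) := by
      apply Tendsto.mono_left _ nhdsWithin_le_nhds
      exact (show Continuous (fun s : ℝ => volume.real (Icc (-R) R) * |s - t|) by fun_prop).tendsto t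
    simpa using (a.add b).const_mul C
  rw [ContinuousWithinAt, tendsto_iff_norm_sub_tendsto_zero]
  refine squeeze_zero' (Eventually.of_forall fun _ => norm_nonneg _) ?_ h2
  filter_upwards [self_mem_nhdsWithin] with s hs
  rw [← integral_sub (S.bint hb (hsub hs)) (S.bint hb (hsub ht))]
  exact (norm_integral_le_integral_norm _).trans (h1 s hs t ht)

def Good (e : ℝ → ℝ → ℝ → ℝ) (k : ℝ → ℝ → ℝ) (R τ1 τ2 t : ℝ) : Prop :=
  ∃ ε > 0, ∀ s1 s2, s1 ≤ s2 → s1 ∈ Icc τ1 τ2 → s2 ∈ Icc τ1 τ2 → |s1 - t| < ε → |s2 - t| < ε →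
    PP e k R s1 s2

lemma isOpen_good (e k R τ1 τ2) : IsOpen {t | Good e k R τ1 τ2 t} := by
  rw [Metric.isOpen_iff]
  rintro t ⟨ε, hε, h⟩
  refine ⟨ε / 2, by positivity, fun t' ht' => ⟨ε / 2, by positivity, ?_⟩⟩
  rw [Metric.mem_ball, Real.dist_eq] at ht'
  intro s1 s2 h12 h1 h2 h3 h4
  refine h s1 s2 h12 h1 h2 ?_ ?_
  · calc |s1 - t| ≤ |s1 - t'| + |t' - t| := abs_sub_le _ _ _
      _ < ε := by linarith
  · calc |s2 - t| ≤ |s2 - t'| + |t' - t| := abs_sub_le _ _ _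
      _ < ε := by linarith

lemma Setup.stepA {e R τ1 τ2} (S : Setup e R τ1 τ2) {k s1 s2} (h12 : s1 ≤ s2)
    (hsub : Icc s1 s2 ⊆ Icc τ1 τ2) (hG : ∀ t ∈ Ioo s1 s2, Good e k R τ1 τ2 t) : PP e k R s1 s2 := by
  rcases h12.eq_or_lt with rfl | hlt
  · exact PP.refl
  intro b db H hb
  set N : ℝ → ℝ := fun s => ∫ x in Icc (-R) R, b s x with hN
  have hNc : ContinuousOn N (Icc s1 s2) := S.cont hsub hb
  have key : ∀ a ∈ Ioo s1 s2, N s2 ≤ N a + H * (s2 - a) := by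
    intro a ha
    have hsa : Icc a s2 ⊆ Icc s1 s2 := Icc_subset_Icc ha.1.le le_rfl
    have hcl : IsClosed ({s | N s - H * s ≤ N a - H * a} ∩ Icc a s2) := by
      have : ContinuousOn (fun s => N s - H * s) (Icc a s2) :=
        (hNc.mono hsa).sub (by fun_prop)
      have := this.preimage_isClosed_of_isClosed isClosed_Icc (isClosed_Iic (a := N a - H * a))
      rwa [inter_comm] at this
    have := hcl.Icc_subset_of_forall_exists_gt (show a ∈ {s | N s - H * s ≤ N a - H * a} by simp) ?_
    · have h := this (right_mem_Icc.2 ha.2.le)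
      simp only [mem_ofPred_eq] at h
      linarith
    · rintro x ⟨hx1, hx2⟩ y hy
      have hxI : x ∈ Ioo s1 s2 := ⟨ha.1.trans_le hx2.1, hx2.2⟩
      obtain ⟨ε, hε, h⟩ := hG x hxI
      have hy : x < y := hy
      set z := min (min y s2) (x + ε / 2) with hz
      have hxz : x < z := by
        rw [hz, lt_min_iff, lt_min_iff]; exact ⟨⟨hy, hx2.2⟩, by linarith⟩
      have hzs : z ≤ s2 := (min_le_left _ _).trans (min_le_right _ _)
      have hzy : z ≤ y := (min_le_left _ _).trans (min_le_left _ _)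
      have hze : z ≤ x + ε / 2 := min_le_right _ _
      refine ⟨z, ?_, hxz, hzy⟩
      have hx' : x ∈ Icc s1 s2 := Ioo_subset_Icc_self hxI
      have hz' : z ∈ Icc s1 s2 := ⟨hx'.1.trans hxz.le, hzs⟩
      have hp := h x z hxz.le (hsub hx') (hsub hz') (by simpa using hε)
        (by rw [abs_of_pos (by linarith)]; linarith) b db H
        (hb.mono (Icc_subset_Icc hx'.1 hz'.2))
      simp only [mem_ofPred_eq] at hx1 ⊢
      change N z ≤ N x + H * (z - x) at hp
      linarith
  have hl : Tendsto (fun a => N a + H * (s2 - a)) (𝓝[>] s1) (𝓝 (N s1 + H * (s2 - s1))) := by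
    have h1 : Tendsto N (𝓝[>] s1) (𝓝 (N s1)) := by
      have := hNc s1 (left_mem_Icc.2 h12)
      rw [ContinuousWithinAt, nhdsWithin_Icc_eq_nhdsGE hlt] at this
      exact this.mono_left (nhdsWithin_mono _ Ioi_subset_Ici_self)
    refine h1.add (Tendsto.mono_left ?_ nhdsWithin_le_nhds)
    exact (show Continuous (fun a : ℝ => H * (s2 - a)) by fun_prop).tendsto s1
  refine ge_of_tendsto hl ?_
  filter_upwards [Ioo_mem_nhdsGT hlt] with a ha using key a ha

lemma Setup.stepC {e R τ1 τ2} (S : Setup e R τ1 τ2) {k T c d} (hT : IsCompact T)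
    (hc : c ∈ T) (hd : d ∈ T) (hsub : T ⊆ Icc c d) (hcd : Icc c d ⊆ Icc τ1 τ2) {K : ℝ}
    (hrow : ∀ s ∈ T, IntegrableOn (k s) (Icc (-R) R) ∧ ∫ x in Icc (-R) R, k s x ≤ K)
    (hgap : ∀ p ∈ Gap T, ∫ x in Icc (-R) R, e p.2 p.1 x ≤ K * (p.2 - p.1))
    (hpp : ∀ p ∈ Gap T, PP e k R p.1 p.2) : PP e k R c d := by
  intro b db H hb
  have := gap_countable T
  obtain ⟨C, hC, hC1⟩ := S.diff hcd hb
  obtain ⟨C', hC', -, hk⟩ := hb.lip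
  set V := volume.real (Icc (-R) R) with hV
  have hpos : ∀ s ∈ Icc c d, 0 < s := fun s hs => S.pos.trans_le (hcd hs).1
  have hsub2 : ∀ p ∈ Gap T, Icc p.1 p.2 ⊆ Icc c d := fun p hp =>
    Icc_subset_Icc (hsub hp.1).1 (hsub hp.2.1).2
  have hid := gap_hasSum hT hc hd hsub (f := fun s => s) (f' := fun _ => 1)
    (fun s _ => hasDerivAt_id s) (by fun_prop)
  have hcol : ∀ x, HasSum (fun p : Gap T => b p.1.2 x - b p.1.1 x)
      (b d x - b c x - ∫ s in T, db s x) := fun x =>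
    gap_hasSum hT hc hd hsub (f := fun s => b s x) (f' := fun s => db s x)
      (fun s hs => hb.hd s (hpos s hs) x) ((hb.hc x).mono (fun s hs => hpos s hs))
  have hFi : ∀ p : Gap T, IntegrableOn (fun x => b p.1.2 x - b p.1.1 x) (Icc (-R) R) := fun p =>
    (S.bint hb (hcd (hsub p.2.2.1))).sub (S.bint hb (hcd (hsub p.2.1)))
  have hsum : Summable (fun p : Gap T => ∫ x in Icc (-R) R, ‖b p.1.2 x - b p.1.1 x‖) := by
    refine Summable.of_nonneg_of_le (fun p => integral_nonneg fun x => norm_nonneg _)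
      (fun p => ?_) (hid.summable.mul_left (C * (K + V)))
    have h1 := hC1 p.1.2 (hsub p.2.2.1) p.1.1 (hsub p.2.1)
    have h2 := hgap p.1 p.2
    rw [abs_of_pos (sub_pos.2 p.2.2.2.1)] at h1
    calc _ ≤ _ := h1
      _ ≤ C * (K * (p.1.2 - p.1.1) + V * (p.1.2 - p.1.1)) := by gcongr
      _ = _ := by ring
  have hS := hasSum_integral_of_summable_integral_norm (μ := volume.restrict (Icc (-R) R)) hFi hsum
  have hts : ∀ x, ∑' p : Gap T, (b p.1.2 x - b p.1.1 x) = b d x - b c x - ∫ s in T, db s x :=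
    fun x => (hcol x).tsum_eq
  simp only [hts] at hS
  -- Fubini part
  set D : ℝ → ℝ → ℝ := fun s x => (Ioi (0:ℝ)).indicator (fun s => db s x) s with hD
  have hDm : Measurable (fun p : ℝ × ℝ => D p.1 p.2) := meas_db hb.hd hb.hx
  have hDe : ∀ s ∈ T, ∀ x, D s x = db s x := fun s hs x =>
    indicator_of_mem (show s ∈ Ioi (0:ℝ) from hpos s (hsub hs)) _
  have hDi : ∀ s ∈ T, IntegrableOn (D s) (Icc (-R) R) ∧
      ∫ x in Icc (-R) R, ‖D s x‖ ≤ C' * (K + V) := by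
    intro s hs
    have hki : IntegrableOn (fun x => C' * (k s x + 1)) (Icc (-R) R) :=
      ((hrow s hs).1.add (integrableOn_const (by simp))).const_mul _
    have hbd : ∀ x ∈ Icc (-R) R, ‖D s x‖ ≤ C' * (k s x + 1) := by
      intro x hx
      rw [hDe s hs]
      exact hk s (hsub hs) x hx
    have hDs : IntegrableOn (D s) (Icc (-R) R) := by
      refine Integrable.mono' hki (hDm.comp measurable_prodMk_left).aestronglyMeasurable ?_
      filter_upwards [ae_restrict_mem measurableSet_Icc] with x hx using hbd x hx
    refine ⟨hDs, ?_⟩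
    calc _ ≤ ∫ x in Icc (-R) R, C' * (k s x + 1) :=
          setIntegral_mono_on hDs.norm hki measurableSet_Icc hbd
      _ = C' * ((∫ x in Icc (-R) R, k s x) + V) := by
          rw [integral_const_mul, integral_add (hrow s hs).1 (integrableOn_const (by simp))]
          simp [hV]
      _ ≤ _ := by gcongr; exact (hrow s hs).2
  have hTfin : volume T ≠ ⊤ := hT.measure_lt_top.ne
  have hprod : Integrable (Function.uncurry D)
      ((volume.restrict T).prod (volume.restrict (Icc (-R) R))) := by
    rw [integrable_prod_iff (f := Function.uncurry D) hDm.aestronglyMeasurable]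
    constructor
    · filter_upwards [ae_restrict_mem hT.measurableSet] with s hs using (hDi s hs).1
    · refine Integrable.mono' (g := fun _ => C' * (K + V)) (integrableOn_const hTfin) ?_ ?_
      · exact (hDm.norm.stronglyMeasurable.integral_prod_right').aestronglyMeasurable
      · filter_upwards [ae_restrict_mem hT.measurableSet] with s hs
        rw [Real.norm_of_nonneg (integral_nonneg fun x => norm_nonneg _)]
        exact (hDi s hs).2
  have hsw := integral_integral_swap hprod
  have hle : ∫ s in T, ∫ x in Icc (-R) R, D s x ≤ H * volume.real T := by
    have : ∫ s in T, ∫ x in Icc (-R) R, D s x ≤ ∫ s in T, H := by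
      refine setIntegral_mono_on hprod.integral_prod_left (integrableOn_const hTfin)
        hT.measurableSet ?_
      intro s hs
      rw [setIntegral_congr_fun measurableSet_Icc (g := db s) (fun x _ => hDe s hs x)]
      exact hb.row s (hsub hs)
    refine this.trans (le_of_eq ?_)
    simp [mul_comm]
  have hin : ∀ x, ∫ s in T, D s x = ∫ s in T, db s x := fun x =>
    setIntegral_congr_fun hT.measurableSet (fun s hs => hDe s hs x)
  have hDx : IntegrableOn (fun x => ∫ s in T, db s x) (Icc (-R) R) := by
    have := hprod.integral_prod_right
    simp only [Function.uncurry, hin] at this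
    exact this
  simp only [hin] at hsw
  have hbb : IntegrableOn (fun x => b d x - b c x) (Icc (-R) R) :=
    (S.bint hb (hcd ⟨(hsub hd).1, le_rfl⟩)).sub (S.bint hb (hcd ⟨le_rfl, (hsub hc).2⟩))
  rw [integral_sub hbb hDx,
    integral_sub (S.bint hb (hcd ⟨(hsub hd).1, le_rfl⟩)) (S.bint hb (hcd ⟨le_rfl, (hsub hc).2⟩))] at hS
  have hfin := hasSum_le (fun p : Gap T => ?_) hS (hid.mul_left H)
  · simp only [integral_const, smul_eq_mul, mul_one, measureReal_restrict_apply_univ] at hfin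
    linarith
  · have h1 := hpp p.1 p.2 b db H (hb.mono (hsub2 p.1 p.2))
    rw [integral_sub (S.bint hb (hcd (hsub p.2.2.1))) (S.bint hb (hcd (hsub p.2.1)))]
    linarith

theorem Setup.main {e R τ1 τ2} (S : Setup e R τ1 τ2) (h12 : τ1 ≤ τ2) {k} (E : ℕ → Set ℝ)
    (hEc : ∀ n, IsClosed (E n)) (hE : Icc τ1 τ2 ⊆ ⋃ n, E n)
    (hrow : ∀ n, ∃ K, ∀ s ∈ E n, s ∈ Icc τ1 τ2 → 
      IntegrableOn (k s) (Icc (-R) R) ∧ ∫ x in Icc (-R) R, k s x ≤ K)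
    (hgap : ∀ n, ∃ K, ∀ c ∈ E n, c ∈ Icc τ1 τ2 → ∀ d ∈ Icc τ1 τ2, c < d → PP e k R c d →
      ∫ x in Icc (-R) R, e d c x ≤ K * (d - c)) : PP e k R τ1 τ2 := by
  by_cases hall : ∀ t ∈ Icc τ1 τ2, Good e k R τ1 τ2 t
  · exact S.stepA h12 le_rfl (fun t ht => hall t (Ioo_subset_Icc_self ht))
  exfalso
  set T := Icc τ1 τ2 ∩ {t | Good e k R τ1 τ2 t}ᶜ with hTdef
  have hT : IsCompact T := isCompact_Icc.inter_right (isOpen_good e k R τ1 τ2).isClosed_compl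
  have hne : T.Nonempty := by
    push Not at hall
    obtain ⟨t, h1, h2⟩ := hall
    exact ⟨t, h1, h2⟩
  have hTn : Nonempty T := hne.to_subtype
  have : CompactSpace T := isCompact_iff_compactSpace.1 hT
  obtain ⟨n, hn⟩ := nonempty_interior_of_iUnion_of_closed (X := T)
    (f := fun n => (Subtype.val : T → ℝ) ⁻¹' (E n))
    (fun n => (hEc n).preimage continuous_subtype_val) (by
      rw [← preimage_iUnion]
      ext t
      simp only [mem_preimage, mem_univ, iff_true]
      exact hE t.2.1)
  obtain ⟨t0, ht0⟩ := hn
  rw [mem_interior_iff_mem_nhds, Metric.mem_nhds_iff] at ht0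
  obtain ⟨ε, hε, hball⟩ := ht0
  have hTE : ∀ t ∈ T, |t - t0| < ε → t ∈ E n := by
    intro t ht h
    have : (⟨t, ht⟩ : T) ∈ Metric.ball t0 ε := by
      rw [Metric.mem_ball, Subtype.dist_eq, Real.dist_eq]; exact h
    exact hball this
  refine t0.2.2 ⟨ε, hε, ?_⟩
  intro s1 s2 hs hs1 hs2 h1 h2
  have hsub : Icc s1 s2 ⊆ Icc τ1 τ2 := Icc_subset_Icc hs1.1 hs2.2
  have hA : ∀ a b, a ≤ b → Icc a b ⊆ Icc s1 s2 → (∀ x ∈ Ioo a b, x ∉ T) → PP e k R a b := by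
    intro a b hab hsb hx
    refine S.stepA hab (hsb.trans hsub) (fun t ht => ?_)
    by_contra hcon
    exact hx t ht ⟨hsub (hsb (Ioo_subset_Icc_self ht)), hcon⟩
  by_cases hemp : (T ∩ Icc s1 s2).Nonempty
  swap
  · refine hA s1 s2 hs le_rfl (fun x hx hxT => hemp ⟨x, hxT, Ioo_subset_Icc_self hx⟩)
  have hT' : IsCompact (T ∩ Icc s1 s2) := hT.inter_right isClosed_Icc
  obtain ⟨c, hc, hc'⟩ := hT'.exists_isLeast hemp
  obtain ⟨d, hd, hd'⟩ := hT'.exists_isGreatest hemp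
  have hcd : c ≤ d := hc' hd
  have hTs : T ∩ Icc s1 s2 ⊆ Icc c d := fun x hx => ⟨hc' hx, hd' hx⟩
  have hcds : Icc c d ⊆ Icc s1 s2 := Icc_subset_Icc hc.2.1 hd.2.2
  have hTE' : ∀ s ∈ T ∩ Icc s1 s2, s ∈ E n := by
    intro s hs
    apply hTE s hs.1
    rw [abs_lt] at h1 h2 ⊢
    constructor <;> linarith [hs.2.1, hs.2.2]
  have p1 : PP e k R s1 c := hA s1 c hc.2.1 (Icc_subset_Icc le_rfl hc.2.2) (by
    intro x hx hxT
    exact absurd (hc' ⟨hxT, hx.1.le, hx.2.le.trans hc.2.2⟩) (not_le.2 hx.2))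
  have p3 : PP e k R d s2 := hA d s2 hd.2.2 (Icc_subset_Icc hd.2.1 le_rfl) (by
    intro x hx hxT
    exact absurd (hd' ⟨hxT, hd.2.1.trans hx.1.le, hx.2.le⟩) (not_le.2 hx.1))
  obtain ⟨K1, hK1⟩ := hrow n
  obtain ⟨K2, hK2⟩ := hgap n
  have hpp : ∀ p ∈ Gap (T ∩ Icc s1 s2), PP e k R p.1 p.2 := by
    rintro p ⟨a1, a2, a3, a4⟩
    refine hA p.1 p.2 a3.le (Icc_subset_Icc a1.2.1 a2.2.2) (fun x hx hxT => a4 x hx ⟨hxT, ?_⟩)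
    exact ⟨a1.2.1.trans hx.1.le, hx.2.le.trans a2.2.2⟩
  have p2 : PP e k R c d := by
    refine S.stepC hT' hc hd hTs (hcds.trans hsub) (K := max K1 K2) ?_ ?_ hpp
    · intro s hs
      obtain ⟨a, b⟩ := hK1 s (hTE' s hs) (hsub hs.2)
      exact ⟨a, b.trans (le_max_left _ _)⟩
    · intro p hp
      have := hK2 p.1 (hTE' _ hp.1) (hsub hp.1.2) p.2 (hsub hp.2.1.2) hp.2.2.1 (hpp p hp)
      refine this.trans ?_
      have := sub_pos.2 hp.2.2.1
      gcongr
      exact le_max_right _ _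
  exact (p1.trans hc.2.1 hcd p2).trans (hc.2.1.trans hcd) hd.2.2 p3

end RegSol

namespace RegSol
open Set Topology

noncomputable def Prim (h : ℝ → ℝ) (r : ℝ) : ℝ := ∫ s in (0:ℝ)..r, h s

lemma Prim_hasDerivAt {h : ℝ → ℝ} (hh : Continuous h) (r : ℝ) : HasDerivAt (Prim h) (h r) r :=
  intervalIntegral.integral_hasDerivAt_right (hh.intervalIntegrable _ _)
    (hh.stronglyMeasurableAtFilter _ _) hh.continuousAt

lemma Prim_zero (h : ℝ → ℝ) : Prim h 0 = 0 := by simp [Prim]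

lemma Prim_continuous {h : ℝ → ℝ} (hh : Continuous h) : Continuous (Prim h) :=
  continuous_iff_continuousAt.2 fun r => (Prim_hasDerivAt hh r).continuousAt

lemma Prim_sub {h : ℝ → ℝ} (hh : Continuous h) (a b : ℝ) : Prim h b - Prim h a = ∫ s in a..b, h s :=
  intervalIntegral.integral_interval_sub_left (hh.intervalIntegrable _ _) (hh.intervalIntegrable _ _)

lemma Prim_sub_le {h : ℝ → ℝ} (hh : Continuous h) {a b C : ℝ} (hC : ∀ s ∈ uIcc a b, |h s| ≤ C) :
    |Prim h b - Prim h a| ≤ C * |b - a| := by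
  rw [Prim_sub hh]
  rw [← Real.norm_eq_abs (∫ s in a..b, h s)]
  apply intervalIntegral.norm_integral_le_of_norm_le_const
  intro x hx
  exact hC x (uIoc_subset_uIcc hx)

lemma Prim_abs_le {h : ℝ → ℝ} (hh : Continuous h) {b C : ℝ} (hC : ∀ s, |s| ≤ |b| → |h s| ≤ C) :
    |Prim h b| ≤ C * |b| := by
  have := Prim_sub_le hh (a := 0) (b := b) (C := C) (fun s hs => hC s (by
    rcases le_total 0 b with h | h
    · rw [uIcc_of_le h] at hs
      rw [abs_of_nonneg hs.1, abs_of_nonneg h]; exact hs.2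
    · rw [uIcc_of_ge h] at hs
      rw [abs_of_nonpos hs.2, abs_of_nonpos h]; linarith [hs.1]))
  simpa [Prim_zero] using this

/-- flux function -/
noncomputable def FF (p : ℝ) : ℝ → ℝ := Prim (fun s => |s| ^ p)

lemma absrpow_cont {p : ℝ} (hp : 0 < p) : Continuous (fun s : ℝ => |s| ^ p) :=
  continuous_abs.rpow_const (fun _ => Or.inr hp.le)

lemma FF_hasDerivAt {p : ℝ} (hp : 0 < p) (r : ℝ) : HasDerivAt (FF p) (|r| ^ p) r :=
  Prim_hasDerivAt (absrpow_cont hp) r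

lemma FF_sub_le {p : ℝ} (hp : 0 < p) {a b M : ℝ} (ha : |a| ≤ M) (hb : |b| ≤ M) :
    |FF p b - FF p a| ≤ M ^ p * |b - a| := by
  refine Prim_sub_le (absrpow_cont hp) (fun s hs => ?_)
  have hs' : |s| ≤ M := by
    rw [abs_le] at ha hb ⊢
    rw [mem_uIcc] at hs
    rcases hs with hs | hs <;> constructor <;> linarith [hs.1, hs.2]
  rw [abs_of_nonneg (by positivity)]
  exact Real.rpow_le_rpow (abs_nonneg _) hs' hp.le

lemma FF_abs_le {p : ℝ} (hp : 0 < p) (b : ℝ) : |FF p b| ≤ |b| ^ p * |b| := by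
  refine Prim_abs_le (absrpow_cont hp) (fun s hs => ?_)
  rw [abs_of_nonneg (by positivity)]
  exact Real.rpow_le_rpow (abs_nonneg _) hs hp.le

structure Beta (δ C0 : ℝ) (β p r : ℝ → ℝ) : Prop where
  hβ : ∀ z, HasDerivAt β (p z) z
  hp : ∀ z, HasDerivAt p (r z) z
  hr : Continuous r
  r0 : ∀ z, 0 ≤ r z
  r1 : ∀ z, r z ≤ C0 / δ
  rs : ∀ z, r z ≠ 0 → 0 ≤ z ∧ z ≤ δ
  p0 : ∀ z, 0 ≤ p z
  p1 : ∀ z, p z ≤ 1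
  pz : ∀ z ≤ 0, p z = 0
  βz : ∀ z ≤ 0, β z = 0
  β0 : ∀ z, 0 ≤ β z
  β1 : ∀ z, β z ≤ max z 0
  β2 : ∀ z, z - δ ≤ β z

lemma exists_beta_one : ∃ C0 β p r, Beta 1 C0 β p r ∧ 0 ≤ C0 := by
  have hcd : ContDiff ℝ 1 Real.smoothTransition := Real.smoothTransition.contDiff
  have hdiff : Differentiable ℝ Real.smoothTransition := hcd.differentiable (by norm_num)
  have hcont : Continuous Real.smoothTransition := hcd.continuous
  have hdc : Continuous (deriv Real.smoothTransition) := hcd.continuous_deriv le_rfl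
  have r0 : ∀ z, 0 ≤ deriv Real.smoothTransition z := fun z =>
    Real.smoothTransition.monotone.deriv_nonneg
  have rs : ∀ z, deriv Real.smoothTransition z ≠ 0 → 0 ≤ z ∧ z ≤ 1 := by
    intro z hz
    by_contra hcon
    apply hz
    rw [not_and_or, not_le, not_le] at hcon
    rcases hcon with h | h
    · have : Real.smoothTransition =ᶠ[𝓝 z] fun _ => 0 := by
        filter_upwards [Iio_mem_nhds h] with y hy
        exact Real.smoothTransition.zero_of_nonpos (le_of_lt hy)
      rw [this.deriv_eq]; simp
    · have : Real.smoothTransition =ᶠ[𝓝 z] fun _ => 1 := by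
        filter_upwards [Ioi_mem_nhds h] with y hy
        exact Real.smoothTransition.one_of_one_le (le_of_lt hy)
      rw [this.deriv_eq]; simp
  obtain ⟨C, hC⟩ := isCompact_Icc.exists_bound_of_continuousOn (s := Icc (0:ℝ) 1) hdc.continuousOn
  have hC0 : 0 ≤ C := (norm_nonneg _).trans (hC 0 (by simp))
  have βz : ∀ z ≤ 0, Prim Real.smoothTransition z = 0 := by
    intro z hz
    have := Prim_sub_le hcont (a := z) (b := 0) (C := 0) (fun s hs => by
      rw [uIcc_of_le hz] at hs
      rw [Real.smoothTransition.zero_of_nonpos hs.2]; simp)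
    simpa [Prim_zero] using this
  have β0 : ∀ z, 0 ≤ Prim Real.smoothTransition z := by
    intro z
    rcases le_total z 0 with h | h
    · rw [βz z h]
    · exact intervalIntegral.integral_nonneg h (fun u _ => Real.smoothTransition.nonneg u)
  refine ⟨C, Prim Real.smoothTransition, Real.smoothTransition, deriv Real.smoothTransition, ?_, hC0⟩
  refine ⟨Prim_hasDerivAt hcont, fun z => (hdiff z).hasDerivAt, hdc, r0, ?_, rs,
    Real.smoothTransition.nonneg, Real.smoothTransition.le_one,
    fun z hz => Real.smoothTransition.zero_of_nonpos hz, βz, β0, ?_, ?_⟩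
  · intro z
    by_cases hz : deriv Real.smoothTransition z = 0
    · rw [hz]; simpa using hC0
    · have := hC z (rs z hz)
      rw [Real.norm_eq_abs] at this
      simpa using (le_abs_self _).trans this
  · intro z
    rcases le_total z 0 with h | h
    · rw [βz z h]; exact le_max_right _ _
    · have := Prim_sub_le hcont (a := 0) (b := z) (C := 1) (fun s _ => by
        rw [abs_of_nonneg (Real.smoothTransition.nonneg s)]; exact Real.smoothTransition.le_one s)
      rw [Prim_zero, sub_zero, sub_zero, abs_of_nonneg h, one_mul] at this
      exact ((le_abs_self _).trans this).trans (le_max_left _ _)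
  · intro z
    rcases le_total z 1 with h | h
    · linarith [β0 z]
    · have h1 : Prim Real.smoothTransition z - Prim Real.smoothTransition 1 = ∫ s in (1:ℝ)..z, (1:ℝ) := by
        rw [Prim_sub hcont]
        apply intervalIntegral.integral_congr
        intro s hs
        rw [uIcc_of_le h] at hs
        exact Real.smoothTransition.one_of_one_le hs.1
      simp at h1
      linarith [β0 1]

lemma exists_beta : ∃ C0, 0 ≤ C0 ∧ ∀ δ > 0, ∃ β p r, Beta δ C0 β p r := by
  obtain ⟨C0, β, p, r, h, hC⟩ := exists_beta_one
  refine ⟨C0, hC, fun δ hδ => ⟨fun z => δ * β (z / δ), fun z => p (z / δ), fun z => r (z / δ) / δ, ?_⟩⟩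
  have hd : ∀ z, HasDerivAt (fun z : ℝ => z / δ) (1 / δ) z := fun z => (hasDerivAt_id z).div_const δ
  refine ⟨?_, ?_, ?_, ?_, ?_, ?_, fun z => h.p0 _, fun z => h.p1 _, ?_, ?_, ?_, ?_, ?_⟩
  · intro z
    have := ((h.hβ (z / δ)).comp z (hd z)).const_mul δ
    refine this.congr_deriv ?_
    field_simp
  · intro z
    have := ((h.hp (z / δ)).comp z (hd z))
    refine this.congr_deriv ?_
    field_simp
  · exact (h.hr.comp (by fun_prop)).div_const _
  · intro z; exact div_nonneg (h.r0 _) hδ.le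
  · intro z
    have := h.r1 (z / δ)
    rw [div_one] at this
    gcongr
  · intro z hz
    have := h.rs (z / δ) (fun h0 => hz (by simp [h0]))
    constructor
    · by_contra hn
      exact absurd this.1 (not_le.2 (div_neg_of_neg_of_pos (not_le.1 hn) hδ))
    · have := (div_le_one hδ).1 this.2; exact this
  · intro z hz; exact h.pz _ (div_nonpos_of_nonpos_of_nonneg hz hδ.le)
  · intro z hz; simp [h.βz _ (div_nonpos_of_nonpos_of_nonneg hz hδ.le)]
  · intro z; exact mul_nonneg hδ.le (h.β0 _)
  · intro z
    have := h.β1 (z / δ)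
    calc δ * β (z / δ) ≤ δ * max (z / δ) 0 := by gcongr
      _ = max z 0 := by rw [mul_max_of_nonneg _ _ hδ.le]; field_simp; simp
  · intro z
    have := h.β2 (z / δ)
    calc z - δ = δ * (z / δ - 1) := by field_simp
      _ ≤ _ := by gcongr

end RegSol

namespace RegSol
open Set Topology

noncomputable def cv (J f : ℝ → ℝ) (x : ℝ) : ℝ := ∫ y, J (x - y) * f y

lemma cv_eq (J f : ℝ → ℝ) :
    cv J f = convolution f J (ContinuousLinearMap.mul ℝ ℝ) volume := by
  funext x
  simp [cv, convolution, mul_comm]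

lemma cv_integrable {J f : ℝ → ℝ} (hJ : Integrable J) (hf : Integrable f) : Integrable (cv J f) := by
  rw [cv_eq]
  exact hf.integrable_convolution _ hJ

lemma cv_integral {J f : ℝ → ℝ} (hJ : Integrable J) (hm : ∫ x, J x = 1) (hf : Integrable f) :
    ∫ x, cv J f x = ∫ x, f x := by
  rw [cv_eq, integral_convolution (ContinuousLinearMap.mul ℝ ℝ) hf hJ]
  simp [hm]

lemma cv_ae {J f : ℝ → ℝ} (hJ : Integrable J) (hf : Integrable f) :
    ∀ᵐ x, Integrable (fun y => J (x - y) * f y) := by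
  have := hf.ae_convolution_exists (ContinuousLinearMap.mul ℝ ℝ) hJ
  filter_upwards [this] with x hx
  have h := hx.integrable
  simpa [mul_comm] using h

lemma cv_abs_le {J f : ℝ → ℝ} (h0 : ∀ x, 0 ≤ J x) (hJ : Integrable J) (hm : ∫ x, J x = 1)
    (hf : Integrable f) : ∫ x, |cv J f x| ≤ ∫ x, |f x| := by
  rw [← cv_integral hJ hm hf.abs]
  refine integral_mono (cv_integrable hJ hf).abs (cv_integrable hJ hf.abs) (fun x => ?_)
  refine (abs_integral_le_integral_abs (f := fun y => J (x - y) * f y)).trans (le_of_eq ?_)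
  refine integral_congr_ae (Eventually.of_forall fun y => ?_)
  simp [abs_mul, abs_of_nonneg (h0 _)]

lemma cv_sub_le {J u v : ℝ → ℝ} (h0 : ∀ x, 0 ≤ J x) (hJ : Integrable J)
    (hu : Integrable u) (hv : Integrable v) :
    ∀ᵐ x, cv J u x - cv J v x ≤ cv J (fun y => max (u y - v y) 0) x := by
  have hw : Integrable (fun y => max (u y - v y) 0) := (hu.sub hv).pos_part
  filter_upwards [cv_ae hJ hu, cv_ae hJ hv, cv_ae hJ hw] with x h1 h2 h3
  rw [cv, cv, cv, ← integral_sub h1 h2]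
  refine integral_mono (h1.sub h2) h3 (fun y => ?_)
  simp only
  rw [← mul_sub]
  exact mul_le_mul_of_nonneg_left (le_max_left _ _) (h0 _)

lemma cv_nonneg {J f : ℝ → ℝ} (h0 : ∀ x, 0 ≤ J x) (hf : ∀ x, 0 ≤ f x) (x : ℝ) : 0 ≤ cv J f x :=
  integral_nonneg fun y => mul_nonneg (h0 _) (hf y)

lemma cv_neg (J f : ℝ → ℝ) (x : ℝ) : cv J (fun y => - f y) x = - cv J f x := by
  simp [cv, integral_neg]

/-- time derivative -/
noncomputable def dt (u : ℝ → ℝ → ℝ) (t x : ℝ) : ℝ := deriv (fun s => u s x) t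

structure Sol (J : ℝ → ℝ) (q α μ : ℝ) (u : ℝ → ℝ → ℝ) : Prop where
  int : ∀ t : ℝ, 0 ≤ t → Integrable (u t)
  con : ∀ t₀ : ℝ, 0 ≤ t₀ →
    Tendsto (fun t => ∫ x, |u t x - u t₀ x|) (𝓝[Ici 0] t₀) (𝓝 0)
  c2 : ∀ t : ℝ, 0 < t → ContDiff ℝ 2 (u t)
  c1 : ∀ x : ℝ, ContDiffOn ℝ 1 (fun s => u s x) (Ioi 0)
  pde : ∀ t : ℝ, 0 < t → ∀ x : ℝ, dt u t x = α * (cv J (u t) x - u t x)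
      + μ * deriv (deriv (u t)) x - |u t x| ^ (q - 1) * deriv (u t) x

variable {J : ℝ → ℝ} {q α μ : ℝ} {u : ℝ → ℝ → ℝ}

lemma Sol.hasDt (h : Sol J q α μ u) {s : ℝ} (hs : 0 < s) (x : ℝ) :
    HasDerivAt (fun r => u r x) (dt u s x) s := by
  have := (h.c1 x).differentiableOn (by norm_num) s hs
  exact (this.differentiableAt (Ioi_mem_nhds hs)).hasDerivAt

lemma Sol.dt_cont (h : Sol J q α μ u) (x : ℝ) : ContinuousOn (fun s => dt u s x) (Ioi 0) :=
  (h.c1 x).continuousOn_deriv_of_isOpen isOpen_Ioi le_rfl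

lemma Sol.t_cont (h : Sol J q α μ u) (x : ℝ) : ContinuousOn (fun s => u s x) (Ioi 0) :=
  (h.c1 x).continuousOn

lemma c2_d1 {f : ℝ → ℝ} (hf : ContDiff ℝ 2 f) (x : ℝ) : HasDerivAt f (deriv f x) x :=
  (hf.differentiable (by norm_num) x).hasDerivAt

lemma c2_cd {f : ℝ → ℝ} (hf : ContDiff ℝ 2 f) : ContDiff ℝ 1 (deriv f) := by
  have : ContDiff ℝ (1 + 1) f := by norm_num; exact hf
  exact (contDiff_succ_iff_deriv.1 this).2.2

lemma c2_d2 {f : ℝ → ℝ} (hf : ContDiff ℝ 2 f) (x : ℝ) :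
    HasDerivAt (deriv f) (deriv (deriv f) x) x :=
  ((c2_cd hf).differentiable (by norm_num) x).hasDerivAt

lemma c2_c0 {f : ℝ → ℝ} (hf : ContDiff ℝ 2 f) : Continuous f := hf.continuous
lemma c2_c1 {f : ℝ → ℝ} (hf : ContDiff ℝ 2 f) : Continuous (deriv f) := (c2_cd hf).continuous
lemma c2_c2 {f : ℝ → ℝ} (hf : ContDiff ℝ 2 f) : Continuous (deriv (deriv f)) :=
  (c2_cd hf).continuous_deriv le_rfl

lemma Sol.neg (h : Sol J q α μ u) : Sol J q α μ (fun t x => - u t x) where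
  int t ht := (h.int t ht).neg
  con t ht := by
    refine (h.con t ht).congr (fun s => ?_)
    congr 1; funext x
    rw [← abs_neg]; congr 1; ring
  c2 t ht := (h.c2 t ht).neg
  c1 x := (h.c1 x).neg
  pde t ht x := by
    have h1 : dt (fun t x => - u t x) t x = - dt u t x := by
      simp [dt]
    have h2 : deriv (fun x => - u t x) = fun x => - deriv (u t) x := by
      funext x; simp
    rw [h1, h2, cv_neg, h.pde t ht x]
    simp only [deriv.fun_neg, abs_neg]
    ring

lemma Sol.norm_cont (h : Sol J q α μ u) : ContinuousOn (fun t => ∫ x, |u t x|) (Ici 0) := by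
  intro t ht
  rw [ContinuousWithinAt, tendsto_iff_norm_sub_tendsto_zero]
  refine squeeze_zero' (Eventually.of_forall fun _ => norm_nonneg _) ?_ (h.con t ht)
  filter_upwards [self_mem_nhdsWithin] with s hs
  rw [← integral_sub (h.int s hs).abs (h.int t ht).abs]
  refine (norm_integral_le_integral_norm _).trans ?_
  refine integral_mono_of_nonneg (Eventually.of_forall fun x => norm_nonneg _)
    ((h.int s hs).sub (h.int t ht)).abs (Eventually.of_forall fun x => ?_)
  exact abs_abs_sub_abs_le_abs_sub _ _

lemma Sol.bound (h : Sol J q α μ u) (T : ℝ) : ∃ G, 0 ≤ G ∧ ∀ t ∈ Icc 0 T, ∫ x, |u t x| ≤ G := by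
  obtain ⟨C, hC⟩ := isCompact_Icc.exists_bound_of_continuousOn (s := Icc 0 T)
    (h.norm_cont.mono (fun t ht => ht.1))
  refine ⟨|C|, abs_nonneg _, fun t ht => ?_⟩
  exact ((le_abs_self _).trans (hC t ht)).trans (le_abs_self _)

/-- integrability of the time derivative on bounded intervals -/
lemma Sol.dt_int (h : Sol J q α μ u) (hq : 1 < q) (hJ : Integrable J) {t : ℝ} (ht : 0 < t) (a b : ℝ) :
    IntegrableOn (dt u t) (Icc a b) := by
  have h1 : dt u t = fun x => α * (cv J (u t) x - u t x)
      + (μ * deriv (deriv (u t)) x - |u t x| ^ (q - 1) * deriv (u t) x) := by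
    funext x; rw [h.pde t ht x]; ring
  rw [h1]
  apply Integrable.add
  · exact (((cv_integrable hJ (h.int t ht.le)).sub (h.int t ht.le)).const_mul α).integrableOn
  · apply Continuous.integrableOn_Icc
    have a0 := c2_c0 (h.c2 t ht)
    have a1 := c2_c1 (h.c2 t ht)
    have a2 := c2_c2 (h.c2 t ht)
    have a3 : Continuous (fun x => |u t x| ^ (q - 1)) :=
      (absrpow_cont (by linarith : 0 < q - 1)).comp a0
    fun_prop

/-- FTC on a symmetric interval -/
lemma ftc_zero {Y Y' : ℝ → ℝ} {R : ℝ} (hR : 0 ≤ R) (h : ∀ x, HasDerivAt Y (Y' x) x)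
    (hc : Continuous Y') (h1 : Y R = 0) (h2 : Y (-R) = 0) : ∫ x in Icc (-R) R, Y' x = 0 := by
  rw [integral_Icc_eq_integral_Ioc, ← intervalIntegral.integral_of_le (by linarith),
    intervalIntegral.integral_eq_sub_of_hasDerivAt (fun x _ => h x) (hc.intervalIntegrable _ _), h1, h2]
  simp

/-- Quantitative C² bounds, closed under pointwise limits. -/
def RC2 (R : ℝ) (n : ℝ) : Set (ℝ → ℝ) :=
  {f | (∀ x ∈ Icc (-R - 1) (R + 1), |f x| ≤ n) ∧
    (∀ x ∈ Icc (-R - 1) (R + 1), ∀ y ∈ Icc (-R - 1) (R + 1), |f x - f y| ≤ n * |x - y|) ∧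
    (∀ x ∈ Icc (-R - 1) (R + 1), ∀ y ∈ Icc (-R - 1) (R + 1), ∀ a b : ℝ, 0 ≤ a → 0 ≤ b → a + b = 1 →
      |f (a * x + b * y) - (a * f x + b * f y)| ≤ a * (n * x ^ 2) + b * (n * y ^ 2)
        - n * (a * x + b * y) ^ 2)}

lemma RC2_closed (R n : ℝ) : IsClosed (RC2 R n) := by
  have e1 : RC2 R n = (⋂ x ∈ Icc (-R - 1) (R + 1), {f | |f x| ≤ n}) ∩
    (⋂ x ∈ Icc (-R - 1) (R + 1), ⋂ y ∈ Icc (-R - 1) (R + 1), {f | |f x - f y| ≤ n * |x - y|}) ∩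
    (⋂ x ∈ Icc (-R - 1) (R + 1), ⋂ y ∈ Icc (-R - 1) (R + 1), ⋂ (a : ℝ) (b : ℝ) (_ : 0 ≤ a)
      (_ : 0 ≤ b) (_ : a + b = 1), {f | |f (a * x + b * y) - (a * f x + b * f y)| ≤
        a * (n * x ^ 2) + b * (n * y ^ 2) - n * (a * x + b * y) ^ 2}) := by
    ext f
    simp only [RC2, mem_inter_iff, mem_iInter, mem_ofPred_eq, and_assoc]
  rw [e1]
  refine (IsClosed.inter ?_ ?_).inter ?_
  · refine isClosed_biInter fun x _ => isClosed_le (by fun_prop) (by fun_prop)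
  · refine isClosed_biInter fun x _ => isClosed_biInter fun y _ =>
      isClosed_le (by fun_prop) (by fun_prop)
  · refine isClosed_biInter fun x _ => isClosed_biInter fun y _ => isClosed_iInter fun a =>
      isClosed_iInter fun b => isClosed_iInter fun _ => isClosed_iInter fun _ =>
      isClosed_iInter fun _ => isClosed_le (by fun_prop) (by fun_prop)

lemma RC2_neg {R n : ℝ} {f : ℝ → ℝ} (h : f ∈ RC2 R n) : (fun x => - f x) ∈ RC2 R n := by
  obtain ⟨h1, h2, h3⟩ := h
  refine ⟨fun x hx => ?_, fun x hx y hy => ?_, fun x hx y hy a b ha hb hab => ?_⟩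
  · simpa using h1 x hx
  · rw [← abs_neg]
    convert h2 x hx y hy using 2
    ring
  · rw [← abs_neg]
    convert h3 x hx y hy a b ha hb hab using 2
    ring

lemma RC2_mono {R n m : ℝ} (hnm : n ≤ m) : RC2 R n ⊆ RC2 R m := by
  rintro f ⟨h1, h2, h3⟩
  refine ⟨fun x hx => (h1 x hx).trans hnm, fun x hx y hy => (h2 x hx y hy).trans (by gcongr),
    fun x hx y hy a b ha hb hab => (h3 x hx y hy a b ha hb hab).trans ?_⟩
  have : 0 ≤ a * x ^ 2 + b * y ^ 2 - (a * x + b * y) ^ 2 := by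
    have hb' : b = 1 - a := by linarith
    have : a * x ^ 2 + b * y ^ 2 - (a * x + b * y) ^ 2 = a * b * (x - y) ^ 2 := by
      subst hb'; ring
    rw [this]; positivity
  nlinarith

lemma RC2_exists {R : ℝ} {f : ℝ → ℝ} (hf : ContDiff ℝ 2 f) : ∃ n : ℕ, f ∈ RC2 R n := by
  obtain ⟨C0, h0⟩ := isCompact_Icc.exists_bound_of_continuousOn (s := Icc (-R - 1) (R + 1))
    (c2_c0 hf).continuousOn
  obtain ⟨C1, h1⟩ := isCompact_Icc.exists_bound_of_continuousOn (s := Icc (-R - 1) (R + 1))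
    (c2_c1 hf).continuousOn
  obtain ⟨C2, h2⟩ := isCompact_Icc.exists_bound_of_continuousOn (s := Icc (-R - 1) (R + 1))
    (c2_c2 hf).continuousOn
  obtain ⟨n, hn⟩ := exists_nat_ge (max C0 (max C1 C2))
  have n0 : C0 ≤ n := (le_max_left _ _).trans hn
  have n1 : C1 ≤ n := ((le_max_left _ _).trans (le_max_right _ _)).trans hn
  have n2 : C2 ≤ n := ((le_max_right _ _).trans (le_max_right _ _)).trans hn
  have conv : ∀ σ : ℝ, |σ| ≤ 1 → ConvexOn ℝ (Icc (-R - 1) (R + 1)) (fun x => (n:ℝ) * x ^ 2 + σ * f x) := by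
    intro σ hσ
    have hd : ∀ x, HasDerivAt (fun x => (n:ℝ) * x ^ 2 + σ * f x) (n * (2 * x) + σ * deriv f x) x := by
      intro x
      have := (((hasDerivAt_id x).pow 2).const_mul (n:ℝ)).add ((c2_d1 hf x).const_mul σ)
      refine this.congr_deriv ?_
      simp
    have hd2 : ∀ x, HasDerivAt (fun x => (n:ℝ) * (2 * x) + σ * deriv f x) (n * 2 + σ * deriv (deriv f) x) x := by
      intro x
      have := (((hasDerivAt_id x).const_mul (2:ℝ)).const_mul (n:ℝ)).add ((c2_d2 hf x).const_mul σ)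
      refine this.congr_deriv ?_
      simp
    have e1 : deriv (fun x => (n:ℝ) * x ^ 2 + σ * f x) = fun x => n * (2 * x) + σ * deriv f x :=
      funext fun x => (hd x).deriv
    refine convexOn_of_deriv2_nonneg (convex_Icc _ _)
      (fun x _ => (hd x).continuousAt.continuousWithinAt)
      (fun x _ => (hd x).differentiableAt.differentiableWithinAt) ?_ ?_
    · rw [e1]; exact fun x _ => (hd2 x).differentiableAt.differentiableWithinAt
    · intro x hx
      simp only [Function.iterate_succ, Function.iterate_zero, Function.comp_apply, id]
      rw [e1, (hd2 x).deriv]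
      have hb := (h2 x (interior_subset hx)).trans n2
      have : |σ * deriv (deriv f) x| ≤ 1 * n := by
        rw [abs_mul]; exact mul_le_mul hσ hb (abs_nonneg _) (by norm_num)
      have h3 := (abs_le.1 this).1
      have : (0:ℝ) ≤ n := Nat.cast_nonneg n
      linarith
  refine ⟨n, fun x hx => (h0 x hx).trans n0, fun x hx y hy => ?_, fun x hx y hy a b ha hb hab => ?_⟩
  · exact (convex_Icc _ _).norm_image_sub_le_of_norm_deriv_le
      (fun z _ => (c2_d1 hf z).differentiableAt) (fun z hz => (h1 z hz).trans n1) hy hx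
  · have a1 := (conv 1 (by simp)).2 hx hy ha hb hab
    have a2 := (conv (-1) (by simp)).2 hx hy ha hb hab
    simp only [smul_eq_mul] at a1 a2
    rw [abs_le]
    constructor <;> nlinarith

lemma RC2_bounds {R n : ℝ} {f : ℝ → ℝ} (hf : ContDiff ℝ 2 f) (h : f ∈ RC2 R n) :
    ∀ x ∈ Icc (-R) R, |f x| ≤ n ∧ |deriv f x| ≤ n ∧ |deriv (deriv f) x| ≤ 2 * n := by
  intro x hx
  obtain ⟨h1, h2, h3⟩ := h
  have hxI : x ∈ Icc (-R - 1) (R + 1) := ⟨by linarith [hx.1], by linarith [hx.2]⟩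
  have hnb : Icc (-R - 1) (R + 1) ∈ 𝓝 x := Icc_mem_nhds (by linarith [hx.1]) (by linarith [hx.2])
  refine ⟨h1 x hxI, ?_, ?_⟩
  · have hn : 0 ≤ n := (abs_nonneg _).trans (h1 x hxI)
    have : LipschitzOnWith (Real.toNNReal n) f (Icc (-R - 1) (R + 1)) := by
      apply LipschitzOnWith.of_dist_le_mul
      intro y hy z hz
      rw [Real.dist_eq, Real.dist_eq, Real.coe_toNNReal n hn]
      exact h2 y hy z hz
    have := norm_deriv_le_of_lipschitzOn hnb this
    rwa [Real.coe_toNNReal n hn] at this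
  · have key : ∀ σ : ℝ, |σ| = 1 → 0 ≤ n * 2 + σ * deriv (deriv f) x := by
      intro σ hσ
      have hd : ∀ x, HasDerivAt (fun x => (n:ℝ) * x ^ 2 + σ * f x) (n * (2 * x) + σ * deriv f x) x := by
        intro x
        have := (((hasDerivAt_id x).pow 2).const_mul (n:ℝ)).add ((c2_d1 hf x).const_mul σ)
        refine this.congr_deriv ?_
        simp
      have hd2 : ∀ x, HasDerivAt (fun x => (n:ℝ) * (2 * x) + σ * deriv f x) (n * 2 + σ * deriv (deriv f) x) x := by
        intro x
        have := (((hasDerivAt_id x).const_mul (2:ℝ)).const_mul (n:ℝ)).add ((c2_d2 hf x).const_mul σ)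
        refine this.congr_deriv ?_
        simp
      have e1 : deriv (fun x => (n:ℝ) * x ^ 2 + σ * f x) = fun x => n * (2 * x) + σ * deriv f x :=
        funext fun x => (hd x).deriv
      have hc : ConvexOn ℝ (Icc (-R - 1) (R + 1)) (fun x => (n:ℝ) * x ^ 2 + σ * f x) := by
        refine ⟨convex_Icc _ _, fun y hy z hz a b ha hb hab => ?_⟩
        have h4 := h3 y hy z hz a b ha hb hab
        simp only [smul_eq_mul]
        have h5 : σ * (f (a * y + b * z) - (a * f y + b * f z)) ≤
            |f (a * y + b * z) - (a * f y + b * f z)| := by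
          refine (le_abs_self _).trans ?_
          rw [abs_mul, hσ, one_mul]
        nlinarith
      have hm := hc.monotoneOn_deriv (fun z _ => (hd z).differentiableAt)
      rw [e1] at hm
      have := hm.derivWithin_nonneg (x := x)
      rwa [derivWithin_of_mem_nhds hnb, (hd2 x).deriv] at this
    have k1 := key 1 (by simp)
    have k2 := key (-1) (by simp)
    rw [abs_le]
    constructor <;> linarith

end RegSol

namespace RegSol
open Set Topology

lemma Beta.pc {δ C0 β p r} (h : Beta δ C0 β p r) : Continuous p :=
  continuous_iff_continuousAt.2 fun z => (h.hp z).continuousAt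

lemma Beta.βc {δ C0 β p r} (h : Beta δ C0 β p r) : Continuous β :=
  continuous_iff_continuousAt.2 fun z => (h.hβ z).continuousAt

lemma lip_of_deriv {f f' : ℝ → ℝ} {C : ℝ} (h : ∀ x, HasDerivAt f (f' x) x) (hC : ∀ x, |f' x| ≤ C)
    (a b : ℝ) : |f a - f b| ≤ C * |a - b| :=
  convex_univ.norm_image_sub_le_of_norm_hasDerivWithin_le
    (fun x _ => (h x).hasDerivWithinAt) (fun x _ => hC x) (mem_univ b) (mem_univ a)

lemma Beta.lip {δ C0 β p r} (h : Beta δ C0 β p r) (a b : ℝ) : |β a - β b| ≤ |a - b| := by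
  have := lip_of_deriv h.hβ (C := 1) (fun x => by rw [abs_of_nonneg (h.p0 x)]; exact h.p1 x) a b
  simpa using this

variable {J : ℝ → ℝ} {q α μ : ℝ}

lemma setInt_abs_le {f : ℝ → ℝ} (hf : Integrable f) (s : Set ℝ) : ∫ x in s, |f x| ≤ ∫ x, |f x| :=
  setIntegral_le_integral hf.abs (Eventually.of_forall fun _ => abs_nonneg _)

lemma vol_Icc {R : ℝ} (hR : 0 ≤ R) : volume.real (Icc (-R) R) = 2 * R := by
  rw [Real.volume_real_Icc_of_le (by linarith)]; ring

/-- elementary quadratic absorption -/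
lemma quad_abs {μ r z D X : ℝ} (hμ : 0 < μ) (hr : 0 ≤ r) (hX : r * D ^ 2 ≤ X) :
    - (μ * r * z ^ 2) + r * z * D ≤ X / (4 * μ) := by
  rw [le_div_iff₀ (by positivity)]
  nlinarith [mul_nonneg hr (sq_nonneg (2 * μ * z - D))]

lemma pmul_le {p a A : ℝ} (h0 : 0 ≤ p) (h1 : p ≤ 1) (h : a ≤ A) (hA : 0 ≤ A) : p * a ≤ A :=
  (mul_le_mul_of_nonneg_left h h0).trans (mul_le_of_le_one_left hA h1)

set_option maxHeartbeats 1000000 in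
lemma gap_row {u : ℝ → ℝ → ℝ} (h : Sol J q α μ u) (h0 : ∀ x, 0 ≤ J x) (hJ : Integrable J)
    (hm : ∫ x, J x = 1) (hq : 1 < q) (hα : 0 < α) (hμ : 0 < μ)
    {s R κ Λ n K G δ C0 : ℝ} (hs : 0 < s) (hR : 0 ≤ R) (hκ : 0 ≤ κ) (hκK : κ ≤ K) (hΛ : 0 ≤ Λ)
    (hδ : 0 < δ) (hC0 : 0 ≤ C0)
    {ζ : ℝ → ℝ} (hζ : ContDiff ℝ 2 ζ)
    (hb : ∀ x ∈ Icc (-R) R, |ζ x| ≤ n ∧ |deriv ζ x| ≤ n ∧ |deriv (deriv ζ) x| ≤ 2 * n)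
    (hG : ∫ x, |u s x| ≤ G) {β p r : ℝ → ℝ} (B : Beta δ C0 β p r)
    (hz1 : u s R - ζ R - κ ≤ 0) (hz2 : u s (-R) - ζ (-R) - κ ≤ 0) :
    ∫ x in Icc (-R) R, p (u s x - ζ x - κ) * (dt u s x - Λ) ≤
      α * (2 * G) + (2 * μ * n + (n + K) ^ (q - 1) * n
        + C0 * δ * ((n + K + δ) ^ (q - 1)) ^ 2 / (4 * μ)) * (2 * R) := by
  set e := q - 1 with he
  have he0 : 0 < e := by linarith
  have hf := h.c2 s hs
  set f := u s with hfdef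
  set ΔF : ℝ → ℝ := fun x => FF e (f x) - FF e (ζ x + κ) with hΔF
  have hzd : ∀ x, HasDerivAt (fun x => f x - ζ x - κ) (deriv f x - deriv ζ x) x := fun x =>
    ((c2_d1 hf x).sub (c2_d1 hζ x)).sub_const κ
  have hFd : ∀ x, HasDerivAt ΔF (|f x| ^ e * deriv f x - |ζ x + κ| ^ e * deriv ζ x) x := fun x =>
    ((FF_hasDerivAt he0 (f x)).comp x (c2_d1 hf x)).sub
      ((FF_hasDerivAt he0 (ζ x + κ)).comp x ((c2_d1 hζ x).add_const κ))
  set Y : ℝ → ℝ := fun x => μ * (p (f x - ζ x - κ) * (deriv f x - deriv ζ x))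
    - p (f x - ζ x - κ) * ΔF x with hY
  set Y' : ℝ → ℝ := fun x => μ * (r (f x - ζ x - κ) * (deriv f x - deriv ζ x) * (deriv f x - deriv ζ x)
      + p (f x - ζ x - κ) * (deriv (deriv f) x - deriv (deriv ζ) x))
    - (r (f x - ζ x - κ) * (deriv f x - deriv ζ x) * ΔF x
      + p (f x - ζ x - κ) * (|f x| ^ e * deriv f x - |ζ x + κ| ^ e * deriv ζ x)) with hY'
  have hpd : ∀ x, HasDerivAt (fun x => p (f x - ζ x - κ))
      (r (f x - ζ x - κ) * (deriv f x - deriv ζ x)) x := fun x =>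
    (B.hp (f x - ζ x - κ)).comp x (hzd x)
  have hYd : ∀ x, HasDerivAt Y (Y' x) x := fun x =>
    (((hpd x).mul ((c2_d2 hf x).sub (c2_d2 hζ x))).const_mul μ).sub ((hpd x).mul (hFd x))
  have c0 := c2_c0 hf
  have c1 := c2_c1 hf
  have c2 := c2_c2 hf
  have k0 := c2_c0 hζ
  have k1 := c2_c1 hζ
  have k2 := c2_c2 hζ
  have cz : Continuous (fun x => f x - ζ x - κ) := by fun_prop
  have cp : Continuous (fun x => p (f x - ζ x - κ)) := B.pc.comp cz
  have cr : Continuous (fun x => r (f x - ζ x - κ)) := B.hr.comp cz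
  have cF : Continuous ΔF := continuous_iff_continuousAt.2 fun x => (hFd x).continuousAt
  have cf : Continuous (fun x => |f x| ^ e) := (absrpow_cont he0).comp c0
  have cζ : Continuous (fun x => |ζ x + κ| ^ e) := (absrpow_cont he0).comp (by fun_prop)
  have hY'c : Continuous Y' := (continuous_const.mul (((cr.mul (c1.sub k1)).mul (c1.sub k1)).add
    (cp.mul (c2.sub k2)))).sub (((cr.mul (c1.sub k1)).mul cF).add (cp.mul ((cf.mul c1).sub (cζ.mul k1))))
  have hYint := ftc_zero hR hYd hY'c (by simp [hY, B.pz _ hz1]) (by simp [hY, B.pz _ hz2])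
  set Cst := 2 * μ * n + (n + K) ^ e * n + C0 * δ * ((n + K + δ) ^ e) ^ 2 / (4 * μ) with hCst
  have hpt : ∀ x ∈ Icc (-R) R, p (f x - ζ x - κ) * (dt u s x - Λ) ≤
      Y' x + (α * (|cv J f x| + |f x|) + Cst) := by
    intro x hx
    obtain ⟨b0, b1, b2⟩ := hb x hx
    have hn : 0 ≤ n := (abs_nonneg _).trans b0
    rw [h.pde s hs x]
    have hp0 := B.p0 (f x - ζ x - κ)
    have hp1 := B.p1 (f x - ζ x - κ)
    have hr0 := B.r0 (f x - ζ x - κ)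
    have hZ : |ζ x + κ| ≤ n + K := by
      refine (abs_add_le _ _).trans ?_
      rw [abs_of_nonneg hκ]; linarith
    have hX : r (f x - ζ x - κ) * (ΔF x) ^ 2 ≤ C0 * δ * ((n + K + δ) ^ e) ^ 2 := by
      by_cases hr : r (f x - ζ x - κ) = 0
      · rw [hr, zero_mul]; positivity
      · obtain ⟨z0, z1⟩ := B.rs _ hr
        have hfb : |f x| ≤ n + K + δ := by
          have : f x = (ζ x + κ) + (f x - ζ x - κ) := by ring
          rw [this]
          refine (abs_add_le _ _).trans ?_
          rw [abs_of_nonneg z0]; linarith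
        have hF := FF_sub_le he0 (hZ.trans (by linarith : n + K ≤ n + K + δ)) hfb
        have h1 : |f x - (ζ x + κ)| ≤ δ := by
          have : f x - (ζ x + κ) = f x - ζ x - κ := by ring
          rw [this, abs_of_nonneg z0]; exact z1
        have hM : 0 ≤ (n + K + δ) ^ e := Real.rpow_nonneg (by linarith) _
        have h2 : |ΔF x| ≤ (n + K + δ) ^ e * δ := hF.trans (by gcongr)
        have h3 : (ΔF x) ^ 2 ≤ ((n + K + δ) ^ e * δ) ^ 2 := by
          rw [← sq_abs]; gcongr
        calc r (f x - ζ x - κ) * (ΔF x) ^ 2 ≤ (C0 / δ) * ((n + K + δ) ^ e * δ) ^ 2 :=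
              mul_le_mul (B.r1 _) h3 (sq_nonneg _) (by positivity)
          _ = _ := by field_simp
    have hquad := quad_abs (z := deriv f x - deriv ζ x) hμ hr0 hX
    have t1 : p (f x - ζ x - κ) * (α * (cv J f x - f x)) ≤ α * (|cv J f x| + |f x|) := by
      have a1 : |cv J f x - f x| ≤ |cv J f x| + |f x| := abs_sub _ _
      have a2 : α * (cv J f x - f x) ≤ α * (|cv J f x| + |f x|) := by
        gcongr; exact (le_abs_self _).trans a1
      have a3 : 0 ≤ α * (|cv J f x| + |f x|) := by positivity
      exact pmul_le hp0 hp1 a2 a3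
    have t2 : p (f x - ζ x - κ) * (μ * deriv (deriv ζ) x) ≤ 2 * μ * n := by
      have a2 : μ * deriv (deriv ζ) x ≤ 2 * μ * n := by
        have := mul_le_mul_of_nonneg_left ((le_abs_self _).trans b2) hμ.le
        linarith
      have a3 : 0 ≤ 2 * μ * n := by positivity
      exact pmul_le hp0 hp1 a2 a3
    have t3 : p (f x - ζ x - κ) * (-(|ζ x + κ| ^ e * deriv ζ x)) ≤ (n + K) ^ e * n := by
      have a1 : |ζ x + κ| ^ e ≤ (n + K) ^ e := Real.rpow_le_rpow (abs_nonneg _) hZ he0.le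
      have a0 : 0 ≤ |ζ x + κ| ^ e := Real.rpow_nonneg (abs_nonneg _) _
      have a2 : -(|ζ x + κ| ^ e * deriv ζ x) ≤ (n + K) ^ e * n := by
        have : |ζ x + κ| ^ e * |deriv ζ x| ≤ (n + K) ^ e * n :=
          mul_le_mul a1 b1 (abs_nonneg _) (a0.trans a1)
        have h5 := mul_le_mul_of_nonneg_left (neg_le_abs (deriv ζ x)) a0
        linarith
      have a3 : 0 ≤ (n + K) ^ e * n := mul_nonneg (a0.trans a1) hn
      exact pmul_le hp0 hp1 a2 a3
    have t4 : 0 ≤ p (f x - ζ x - κ) * Λ := mul_nonneg hp0 hΛ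
    simp only [hY', hCst]
    linear_combination t1 + t2 + t3 + t4 + hquad
  have hi1 : IntegrableOn (fun x => p (f x - ζ x - κ) * (dt u s x - Λ)) (Icc (-R) R) := by
    have := ((h.dt_int hq hJ hs (-R) R).sub (integrableOn_const (C := Λ) (by simp)))
    refine Integrable.bdd_mul (c := 1) this cp.aestronglyMeasurable ?_
    filter_upwards with x
    rw [Real.norm_eq_abs, abs_of_nonneg (B.p0 _)]; exact B.p1 _
  have hcv := cv_integrable hJ (h.int s hs.le)
  have hi2 : IntegrableOn (fun x => α * (|cv J f x| + |f x|)) (Icc (-R) R) :=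
    ((hcv.abs.add (h.int s hs.le).abs).const_mul α).integrableOn
  have hi3 : IntegrableOn (fun _ : ℝ => Cst) (Icc (-R) R) := integrableOn_const (by simp)
  have hi4 : IntegrableOn Y' (Icc (-R) R) := hY'c.integrableOn_Icc
  have hi5 : IntegrableOn (fun x => α * (|cv J f x| + |f x|) + Cst) (Icc (-R) R) := hi2.add hi3
  calc _ ≤ ∫ x in Icc (-R) R, (Y' x + (α * (|cv J f x| + |f x|) + Cst)) :=
        setIntegral_mono_on hi1 (hi4.add hi5) measurableSet_Icc hpt
    _ = α * ((∫ x in Icc (-R) R, |cv J f x|) + ∫ x in Icc (-R) R, |f x|) + Cst * (2 * R) := by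
        rw [integral_add hi4 hi5, hYint, integral_add hi2 hi3, integral_const_mul,
          integral_add hcv.abs.integrableOn (h.int s hs.le).abs.integrableOn]
        rw [setIntegral_const, vol_Icc hR, smul_eq_mul]
        ring
    _ ≤ _ := by
        have a1 := (setInt_abs_le hcv (Icc (-R) R)).trans ((cv_abs_le h0 hJ hm (h.int s hs.le)).trans hG)
        have a2 := (setInt_abs_le (h.int s hs.le) (Icc (-R) R)).trans hG
        gcongr
        linarith


/-- columns are Lipschitz in time -/
lemma Sol.col_lip {u : ℝ → ℝ → ℝ} (h : Sol J q α μ u) {τ1 τ2 : ℝ} (hτ : 0 < τ1) (x : ℝ) :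
    ∃ Λ, 0 ≤ Λ ∧ ∀ s ∈ Icc τ1 τ2, ∀ c ∈ Icc τ1 τ2, |u s x - u c x| ≤ Λ * |s - c| := by
  have hsub : Icc τ1 τ2 ⊆ Ioi (0:ℝ) := fun s hs => hτ.trans_le hs.1
  obtain ⟨C, hC⟩ := isCompact_Icc.exists_bound_of_continuousOn (s := Icc τ1 τ2)
    ((h.dt_cont x).mono hsub)
  refine ⟨|C|, abs_nonneg _, fun s hs c hc => ?_⟩
  exact (convex_Icc τ1 τ2).norm_image_sub_le_of_norm_hasDerivWithin_le
    (fun t ht => (h.hasDt (hsub ht) x).hasDerivWithinAt)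
    (fun t ht => (hC t ht).trans (le_abs_self _)) hc hs

lemma gap_est {u : ℝ → ℝ → ℝ} (h : Sol J q α μ u) (h0 : ∀ x, 0 ≤ J x) (hJ : Integrable J)
    (hm : ∫ x, J x = 1) (hq : 1 < q) (hα : 0 < α) (hμ : 0 < μ)
    {R τ1 τ2 : ℝ} (hR : 0 ≤ R) (hτ : 0 < τ1) (n : ℝ) {e : ℝ → ℝ → ℝ → ℝ} {k : ℝ → ℝ → ℝ}
    (he : ∀ s t x, |u s x - u t x| ≤ e s t x) (hk : ∀ s x, |dt u s x| ≤ k s x) :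
    ∃ K, ∀ c ∈ Icc τ1 τ2, u c ∈ RC2 R n → ∀ d ∈ Icc τ1 τ2, c < d → PP e k R c d →
      ∫ x in Icc (-R) R, max (u d x - u c x) 0 ≤ K * (d - c) := by
  obtain ⟨Λ1, hΛ1, hl1⟩ := h.col_lip (τ2 := τ2) hτ R
  obtain ⟨Λ2, hΛ2, hl2⟩ := h.col_lip (τ2 := τ2) hτ (-R)
  obtain ⟨G, hG0, hG⟩ := h.bound τ2
  obtain ⟨C0, hC0, hB⟩ := exists_beta
  set Λ := max Λ1 Λ2 with hΛ
  have hΛ0 : 0 ≤ Λ := hΛ1.trans (le_max_left _ _)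
  set Δ := τ2 - τ1 with hΔ
  set H := α * (2 * G) + (2 * μ * n + (n + Λ * Δ) ^ (q - 1) * n
        + C0 * Δ * ((n + Λ * Δ + Δ) ^ (q - 1)) ^ 2 / (4 * μ)) * (2 * R) with hH
  refine ⟨H + (1 + Λ) * (2 * R), fun c hc hcn d hd hcd hPP => ?_⟩
  have hcpos : 0 < c := hτ.trans_le hc.1
  have hΔ0 : 0 < Δ := by rw [hΔ]; linarith [hc.1, hd.2]
  obtain ⟨β, p, r, B⟩ := hB (d - c) (sub_pos.2 hcd)
  have hζ := h.c2 c hcpos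
  have hbd := RC2_bounds hζ hcn
  have hn : 0 ≤ n := (abs_nonneg _).trans (hbd R ⟨by linarith, le_rfl⟩).1
  have hzt : ∀ s, 0 < s → ∀ x, HasDerivAt (fun s => u s x - u c x - Λ * (s - c)) (dt u s x - Λ) s := by
    intro s hs x
    have := ((h.hasDt hs x).sub_const (u c x)).sub (((hasDerivAt_id s).sub_const c).const_mul Λ)
    refine this.congr_deriv ?_
    ring
  have hcls : Cls e k R c d H (fun s x => β (u s x - u c x - Λ * (s - c)))
      (fun s x => p (u s x - u c x - Λ * (s - c)) * (dt u s x - Λ)) := by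
    refine ⟨fun s hs x => (B.hβ _).comp s (hzt s hs x), ?_, ?_, ?_, ?_⟩
    · intro x
      have hc1 : ContinuousOn (fun s => u s x - u c x - Λ * (s - c)) (Ioi 0) := fun s hs =>
        (hzt s hs x).continuousAt.continuousWithinAt
      exact (B.pc.comp_continuousOn hc1).mul ((h.dt_cont x).sub continuousOn_const)
    · intro s hs
      have := c2_c0 (h.c2 s hs)
      have := c2_c0 hζ
      exact B.βc.comp (by fun_prop)
    · refine ⟨1 + Λ, by linarith, fun s hs t ht x hx => ?_, fun s hs x hx => ?_⟩
      · refine (B.lip _ _).trans ?_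
        have h1 : u s x - u c x - Λ * (s - c) - (u t x - u c x - Λ * (t - c))
          = (u s x - u t x) - Λ * (s - t) := by ring
        rw [h1]
        refine (abs_sub _ _).trans ?_
        rw [abs_mul, abs_of_nonneg hΛ0]
        have h2 := he s t x
        have h3 : 0 ≤ e s t x := (abs_nonneg _).trans h2
        have h4 := abs_nonneg (s - t)
        nlinarith [mul_nonneg hΛ0 h3]
      · rw [abs_mul, abs_of_nonneg (B.p0 _)]
        have h2 := hk s x
        have h3 : 0 ≤ k s x := (abs_nonneg _).trans h2
        refine pmul_le (B.p0 _) (B.p1 _) ?_ (by positivity)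
        refine (abs_sub _ _).trans ?_
        rw [abs_of_nonneg hΛ0]
        nlinarith [mul_nonneg hΛ0 h3]
    · intro s hs
      have hspos : 0 < s := hcpos.trans_le hs.1
      have hsτ : s ∈ Icc τ1 τ2 := ⟨hc.1.trans hs.1, hs.2.trans hd.2⟩
      have hsc : 0 ≤ s - c := sub_nonneg.2 hs.1
      have hscΔ : s - c ≤ Δ := by rw [hΔ]; linarith [hsτ.2, hc.1]
      have hz : ∀ y Λ', Λ' ≤ Λ → |u s y - u c y| ≤ Λ' * |s - c| → u s y - u c y - Λ * (s - c) ≤ 0 := by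
        intro y Λ' hΛ' hy
        rw [abs_of_nonneg hsc] at hy
        have := mul_le_mul_of_nonneg_right hΛ' hsc
        linarith [le_abs_self (u s y - u c y)]
      have hrow := gap_row h h0 hJ hm hq hα hμ (κ := Λ * (s - c)) (K := Λ * Δ) (Λ := Λ) (G := G) hspos hR
        (mul_nonneg hΛ0 hsc) (by gcongr) hΛ0 (sub_pos.2 hcd) hC0 hζ hbd
        (hG s ⟨hspos.le, hsτ.2⟩) B (hz R Λ1 (le_max_left _ _) (hl1 s hsτ c hc))
        (hz (-R) Λ2 (le_max_right _ _) (hl2 s hsτ c hc))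
      refine hrow.trans ?_
      have hdc : d - c ≤ Δ := by rw [hΔ]; linarith [hd.2, hc.1]
      have hdc0 : 0 ≤ d - c := by linarith
      have hΛΔ : 0 ≤ Λ * Δ := by positivity
      have hpw : (n + Λ * Δ + (d - c)) ^ (q - 1) ≤ (n + Λ * Δ + Δ) ^ (q - 1) :=
        Real.rpow_le_rpow (by positivity) (by linarith) (by linarith)
      have hpw0 : 0 ≤ (n + Λ * Δ + (d - c)) ^ (q - 1) := Real.rpow_nonneg (by positivity) _
      rw [hH]
      gcongr
  have hmain := hPP _ _ H hcls
  have hb0 : ∫ x in Icc (-R) R, β (u c x - u c x - Λ * (c - c)) = 0 := by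
    simp [B.βz 0 le_rfl]
  simp only [hb0] at hmain
  have hdpos : 0 < d := hcpos.trans hcd
  have cd := c2_c0 (h.c2 d hdpos)
  have cc := c2_c0 hζ
  have i1 : IntegrableOn (fun x => β (u d x - u c x - Λ * (d - c))) (Icc (-R) R) :=
    (B.βc.comp (by fun_prop)).integrableOn_Icc
  have i2 : IntegrableOn (fun _ : ℝ => (1 + Λ) * (d - c)) (Icc (-R) R) := integrableOn_const (by simp)
  calc ∫ x in Icc (-R) R, max (u d x - u c x) 0
      ≤ ∫ x in Icc (-R) R, (β (u d x - u c x - Λ * (d - c)) + (1 + Λ) * (d - c)) := by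
        refine setIntegral_mono_on (Continuous.integrableOn_Icc (by fun_prop)) (i1.add i2)
          measurableSet_Icc (fun x _ => ?_)
        have := B.β2 (u d x - u c x - Λ * (d - c))
        have h5 : 0 ≤ (1 + Λ) * (d - c) := mul_nonneg (by linarith) (by linarith)
        refine max_le (by linarith) (add_nonneg (B.β0 _) h5)
    _ = (∫ x in Icc (-R) R, β (u d x - u c x - Λ * (d - c))) + (1 + Λ) * (2 * R) * (d - c) := by
        rw [integral_add i1 i2, setIntegral_const, vol_Icc hR, smul_eq_mul]; ring
    _ ≤ _ := by linarith

/-- The basic inequality for admissible functionals of two solutions. -/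
theorem pp_holds {u v : ℝ → ℝ → ℝ} (hu : Sol J q α μ u) (hv : Sol J q α μ v)
    (h0 : ∀ x, 0 ≤ J x) (hJ : Integrable J)
    (hm : ∫ x, J x = 1) (hq : 1 < q) (hα : 0 < α) (hμ : 0 < μ)
    {R τ1 τ2 : ℝ} (hR : 0 ≤ R) (hτ : 0 < τ1) (h12 : τ1 ≤ τ2) :
    PP (fun s t x => |u s x - u t x| + |v s x - v t x|) (fun s x => |dt u s x| + |dt v s x|) R τ1 τ2 := by
  set e : ℝ → ℝ → ℝ → ℝ := fun s t x => |u s x - u t x| + |v s x - v t x| with he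
  set k : ℝ → ℝ → ℝ := fun s x => |dt u s x| + |dt v s x| with hk
  have hi : ∀ {w}, Sol J q α μ w → ∀ s ∈ Icc τ1 τ2, ∀ t ∈ Icc τ1 τ2,
      Integrable (fun x => |w s x - w t x|) := fun hw s hs t ht =>
    ((hw.int s (hτ.le.trans hs.1)).sub (hw.int t (hτ.le.trans ht.1))).abs
  have S : Setup e R τ1 τ2 := by
    refine ⟨hτ, fun s t x => by positivity, fun s hs t ht =>
      ((hi hu s hs t ht).add (hi hv s hs t ht)).integrableOn, fun t ht => ?_⟩
    have hsub : Icc τ1 τ2 ⊆ Ici (0:ℝ) := fun s hs => hτ.le.trans hs.1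
    have h1 := ((hu.con t (hsub ht)).add (hv.con t (hsub ht))).mono_left (nhdsWithin_mono t hsub)
    rw [add_zero] at h1
    refine squeeze_zero' (Eventually.of_forall fun s => integral_nonneg fun x => by positivity) ?_ h1
    filter_upwards [self_mem_nhdsWithin] with s hs
    rw [← integral_add (hi hu s hs t ht) (hi hv s hs t ht)]
    exact setIntegral_le_integral ((hi hu s hs t ht).add (hi hv s hs t ht))
      (Eventually.of_forall fun x => by simp only [Pi.zero_apply]; positivity)
  have hsub0 : Icc τ1 τ2 ⊆ Ioi (0:ℝ) := fun s hs => hτ.trans_le hs.1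
  refine S.main h12 (fun n : ℕ => Icc τ1 τ2 ∩ (fun t => u t) ⁻¹' (RC2 R n) ∩
    (Icc τ1 τ2 ∩ (fun t => v t) ⁻¹' (RC2 R n))) ?_ ?_ ?_ ?_
  · intro n
    have hcl : ∀ {w}, Sol J q α μ w → IsClosed (Icc τ1 τ2 ∩ (fun t => w t) ⁻¹' (RC2 R n)) := by
      intro w hw
      have : ContinuousOn (fun t => w t) (Icc τ1 τ2) :=
        continuousOn_pi.2 fun x => (hw.t_cont x).mono hsub0
      exact this.preimage_isClosed_of_isClosed isClosed_Icc (RC2_closed R n)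
    exact (hcl hu).inter (hcl hv)
  · intro t ht
    obtain ⟨n1, h1⟩ := RC2_exists (R := R) (hu.c2 t (hsub0 ht))
    obtain ⟨n2, h2⟩ := RC2_exists (R := R) (hv.c2 t (hsub0 ht))
    refine mem_iUnion.2 ⟨max n1 n2, ⟨ht, RC2_mono (by simp) h1⟩, ⟨ht, RC2_mono (by simp) h2⟩⟩
  · intro n
    have key : ∀ {w}, Sol J q α μ w → ∃ K, ∀ s ∈ Icc τ1 τ2, w s ∈ RC2 R n →
        ∫ x in Icc (-R) R, |dt w s x| ≤ K := by
      intro w hw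
      obtain ⟨G, hG0, hG⟩ := hw.bound τ2
      refine ⟨α * (2 * G) + (2 * μ * n + (n:ℝ) ^ (q - 1) * n) * (2 * R), fun s hs hsn => ?_⟩
      have hs0 := hsub0 hs
      have hcv := cv_integrable hJ (hw.int s hs0.le)
      have i1 : IntegrableOn (fun x => α * (|cv J (w s) x| + |w s x|)) (Icc (-R) R) :=
        ((hcv.abs.add (hw.int s hs0.le).abs).const_mul α).integrableOn
      have i2 : IntegrableOn (fun _ : ℝ => 2 * μ * n + (n:ℝ) ^ (q - 1) * n) (Icc (-R) R) :=
        integrableOn_const (by simp)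
      calc _ ≤ ∫ x in Icc (-R) R, (α * (|cv J (w s) x| + |w s x|) + (2 * μ * n + (n:ℝ) ^ (q - 1) * n)) := by
            refine setIntegral_mono_on (hw.dt_int hq hJ hs0 _ _).abs (i1.add i2) measurableSet_Icc
              (fun x hx => ?_)
            obtain ⟨b0, b1, b2⟩ := RC2_bounds (hw.c2 s hs0) hsn x hx
            rw [hw.pde s hs0 x]
            have a1 : |α * (cv J (w s) x - w s x)| ≤ α * (|cv J (w s) x| + |w s x|) := by
              rw [abs_mul, abs_of_pos hα]
              gcongr
              exact abs_sub _ _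
            have a2 : |μ * deriv (deriv (w s)) x| ≤ 2 * μ * n := by
              rw [abs_mul, abs_of_pos hμ]
              have := mul_le_mul_of_nonneg_left b2 hμ.le
              linarith
            have a3 : |(|w s x| ^ (q - 1) * deriv (w s) x)| ≤ (n:ℝ) ^ (q - 1) * n := by
              rw [abs_mul, abs_of_nonneg (Real.rpow_nonneg (abs_nonneg _) _)]
              have := Real.rpow_le_rpow (abs_nonneg _) b0 (by linarith : 0 ≤ q - 1)
              gcongr
            have := abs_add_le (α * (cv J (w s) x - w s x)) (μ * deriv (deriv (w s)) x)
            have := abs_sub (α * (cv J (w s) x - w s x) + μ * deriv (deriv (w s)) x)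
              (|w s x| ^ (q - 1) * deriv (w s) x)
            linarith
        _ = α * ((∫ x in Icc (-R) R, |cv J (w s) x|) + ∫ x in Icc (-R) R, |w s x|)
              + (2 * μ * n + (n:ℝ) ^ (q - 1) * n) * (2 * R) := by
            rw [integral_add i1 i2, integral_const_mul,
              integral_add hcv.abs.integrableOn (hw.int s hs0.le).abs.integrableOn,
              setIntegral_const, vol_Icc hR, smul_eq_mul]
            ring
        _ ≤ _ := by
            have hG' := hG s ⟨hs0.le, hs.2⟩
            have a1 := (setInt_abs_le hcv (Icc (-R) R)).trans
              ((cv_abs_le h0 hJ hm (hw.int s hs0.le)).trans hG')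
            have a2 := (setInt_abs_le (hw.int s hs0.le) (Icc (-R) R)).trans hG'
            gcongr
            linarith
    obtain ⟨K1, hK1⟩ := key hu
    obtain ⟨K2, hK2⟩ := key hv
    refine ⟨K1 + K2, fun s hs hsτ => ?_⟩
    have j1 := (hu.dt_int hq hJ (hsub0 hsτ) (-R) R).abs
    have j2 := (hv.dt_int hq hJ (hsub0 hsτ) (-R) R).abs
    refine ⟨j1.add j2, ?_⟩
    rw [hk, integral_add j1 j2]
    exact add_le_add (hK1 s hsτ hs.1.2) (hK2 s hsτ hs.2.2)
  · intro n
    have key : ∀ {w}, Sol J q α μ w → (∀ s t x, |w s x - w t x| ≤ e s t x) →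
        (∀ s x, |dt w s x| ≤ k s x) → ∃ K, ∀ c ∈ Icc τ1 τ2, w c ∈ RC2 R n → ∀ d ∈ Icc τ1 τ2, c < d →
        PP e k R c d → ∫ x in Icc (-R) R, |w d x - w c x| ≤ K * (d - c) := by
      intro w hw hwe hwk
      obtain ⟨K1, hK1⟩ := gap_est hw h0 hJ hm hq hα hμ hR (τ2 := τ2) hτ n hwe hwk
      have hdn : ∀ s x, dt (fun t x => - w t x) s x = - dt w s x := fun s x => by simp [dt]
      obtain ⟨K2, hK2⟩ := gap_est hw.neg h0 hJ hm hq hα hμ hR (τ2 := τ2) hτ n (e := e) (k := k)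
        (fun s t x => by
          have : - w s x - - w t x = - (w s x - w t x) := by ring
          rw [this, abs_neg]; exact hwe s t x)
        (fun s x => by rw [hdn, abs_neg]; exact hwk s x)
      refine ⟨K1 + K2, fun c hc hcn d hd hcd hP => ?_⟩
      have r1 := hK1 c hc hcn d hd hcd hP
      have r2 := hK2 c hc (RC2_neg hcn) d hd hcd hP
      have cd := c2_c0 (hw.c2 d (hsub0 hd))
      have cc := c2_c0 (hw.c2 c (hsub0 hc))
      have e1 : ∀ x, |w d x - w c x| = max (w d x - w c x) 0 + max (- w d x - - w c x) 0 := by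
        intro x
        rcases le_total 0 (w d x - w c x) with h | h
        · rw [abs_of_nonneg h, max_eq_left h, max_eq_right (by linarith), add_zero]
        · rw [abs_of_nonpos h, max_eq_right h, max_eq_left (by linarith), zero_add]; ring
      simp only [e1]
      rw [integral_add (Continuous.integrableOn_Icc (by fun_prop)) (Continuous.integrableOn_Icc (by fun_prop))]
      linarith
    obtain ⟨K1, hK1⟩ := key hu (fun s t x => by simp only [he]; linarith [abs_nonneg (v s x - v t x)])
      (fun s x => by simp only [hk]; linarith [abs_nonneg (dt v s x)])
    obtain ⟨K2, hK2⟩ := key hv (fun s t x => by simp only [he]; linarith [abs_nonneg (u s x - u t x)])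
      (fun s x => by simp only [hk]; linarith [abs_nonneg (dt u s x)])
    refine ⟨K1 + K2, fun c hc hcτ d hd hcd hP => ?_⟩
    have r1 := hK1 c hcτ hc.1.2 d hd hcd hP
    have r2 := hK2 c hcτ hc.2.2 d hd hcd hP
    have : ∫ x in Icc (-R) R, e d c x = (∫ x in Icc (-R) R, |u d x - u c x|) +
        ∫ x in Icc (-R) R, |v d x - v c x| :=
      integral_add (hi hu d hd c hcτ).integrableOn (hi hv d hd c hcτ).integrableOn
    rw [this]
    linarith

end RegSol

namespace RegSol
open Set Topology

/-- second derivative of the auxiliary convex entropy -/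
noncomputable def B2 (a r : ℝ) : ℝ := (1 + r ^ 2) ^ (a - 1)
noncomputable def B1 (a : ℝ) : ℝ → ℝ := Prim (B2 a)
noncomputable def B0 (a : ℝ) : ℝ → ℝ := Prim (B1 a)
noncomputable def Qh (a e : ℝ) : ℝ → ℝ := Prim (fun r => B1 a r * |r| ^ e)
noncomputable def QQ (a r : ℝ) : ℝ := (1 + r ^ 2) ^ a - 1

lemma B2_cont (a : ℝ) : Continuous (B2 a) := by
  unfold B2
  exact Continuous.rpow_const (by fun_prop) (fun x => Or.inl (by positivity))

lemma B2_pos (a r : ℝ) : 0 < B2 a r := by unfold B2; positivity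

lemma B1_cont (a : ℝ) : Continuous (B1 a) := Prim_continuous (B2_cont a)

lemma B1_bound {a : ℝ} (ha : a < 1 / 2) : ∃ C, 0 ≤ C ∧ ∀ r, |B1 a r| ≤ C := by
  have hi : Integrable (B2 a) := by
    have := integrable_rpow_neg_one_add_norm_sq (E := ℝ) (μ := volume) (r := 2 - 2 * a) (by simp; linarith)
    refine this.congr (Eventually.of_forall fun x => ?_)
    simp only [B2, Real.norm_eq_abs, sq_abs]
    congr 1; ring
  refine ⟨∫ x, ‖B2 a x‖, integral_nonneg fun x => norm_nonneg _, fun r => ?_⟩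
  refine (intervalIntegral.norm_integral_le_integral_norm_uIoc (f := B2 a)).trans ?_
  exact setIntegral_le_integral hi.norm (Eventually.of_forall fun x => norm_nonneg _)

lemma B0_bound {a C : ℝ} (h : ∀ r, |B1 a r| ≤ C) (r : ℝ) : |B0 a r| ≤ C * |r| :=
  Prim_abs_le (B1_cont a) (fun s _ => h s)

lemma Qh_cont (a : ℝ) {e : ℝ} (he : 0 < e) : Continuous (fun r => B1 a r * |r| ^ e) :=
  (B1_cont a).mul (absrpow_cont he)

lemma Qh_bound {a e C : ℝ} (he : 0 < e) (h : ∀ r, |B1 a r| ≤ C) (r : ℝ) :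
    |Qh a e r| ≤ C * |r| ^ e * |r| := by
  refine Prim_abs_le (Qh_cont a he) (fun s hs => ?_)
  rw [abs_mul, abs_of_nonneg (Real.rpow_nonneg (abs_nonneg s) e)]
  exact mul_le_mul (h s) (Real.rpow_le_rpow (abs_nonneg _) hs he.le) (Real.rpow_nonneg (abs_nonneg s) e)
    ((abs_nonneg _).trans (h s))

lemma QQ_deriv (a r : ℝ) : HasDerivAt (QQ a) (2 * a * r * B2 a r) r := by
  have h1 : HasDerivAt (fun r : ℝ => 1 + r ^ 2) (2 * r) r := by
    have := ((hasDerivAt_id r).pow 2).const_add 1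
    refine this.congr_deriv ?_
    simp
  have := (h1.rpow_const (p := a) (Or.inl (by positivity))).sub_const 1
  refine this.congr_deriv ?_
  unfold B2; ring

lemma one_le_sq (r : ℝ) : 1 ≤ 1 + r ^ 2 := by nlinarith [sq_nonneg r]

lemma QQ_nonneg {a : ℝ} (ha : 0 ≤ a) (r : ℝ) : 0 ≤ QQ a r := by
  have := Real.one_le_rpow (one_le_sq r) ha
  unfold QQ; linarith

lemma sqrt_bd (r : ℝ) : (1 + r ^ 2) ^ (1 / 2 : ℝ) ≤ 1 + |r| := by
  rw [← Real.sqrt_eq_rpow]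
  apply Real.sqrt_le_iff.2 ⟨by positivity, ?_⟩
  nlinarith [sq_abs r, abs_nonneg r]

lemma QQ_le {a : ℝ} (ha : a ≤ 1 / 2) (r : ℝ) : QQ a r ≤ |r| := by
  have := Real.rpow_le_rpow_of_exponent_le (one_le_sq r) ha
  have := sqrt_bd r
  unfold QQ; linarith

lemma B2_mul_le {a : ℝ} (ha : a ≤ 1 / 2) (r : ℝ) : B2 a r * |r| ≤ 1 := by
  have h1 : B2 a r ≤ (1 + r ^ 2) ^ (-(1 / 2) : ℝ) :=
    Real.rpow_le_rpow_of_exponent_le (one_le_sq r) (by linarith)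
  have h2 : |r| ≤ (1 + r ^ 2) ^ (1 / 2 : ℝ) := by
    rw [← Real.sqrt_eq_rpow]
    apply Real.le_sqrt_of_sq_le
    rw [sq_abs]; linarith
  calc B2 a r * |r| ≤ (1 + r ^ 2) ^ (-(1 / 2) : ℝ) * (1 + r ^ 2) ^ (1 / 2 : ℝ) := by gcongr
    _ = 1 := by rw [← Real.rpow_add (by positivity)]; simp

lemma QQ'_le {a : ℝ} (ha0 : 0 ≤ a) (ha : a ≤ 1 / 2) (r y : ℝ) :
    |2 * a * r * B2 a r * y| ≤ |r| + B2 a r * y ^ 2 := by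
  have hB := (B2_pos a r).le
  have h1 := B2_mul_le ha r
  have h2 : |2 * a * r * B2 a r * y| = 2 * a * (B2 a r * (|r| * |y|)) := by
    rw [abs_mul, abs_mul, abs_mul, abs_mul, abs_of_nonneg hB, abs_of_nonneg ha0]
    simp; ring
  have h3 : B2 a r * (|r| * |y|) ≤ B2 a r * ((r ^ 2 + y ^ 2) / 2) := by
    gcongr
    nlinarith [sq_abs r, sq_abs y, sq_nonneg (|r| - |y|)]
  have h4 : B2 a r * r ^ 2 ≤ |r| := by
    rw [← sq_abs]
    nlinarith [abs_nonneg r]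
  have h5 : 0 ≤ B2 a r * (|r| * |y|) := by positivity
  have h6 : 0 ≤ B2 a r * y ^ 2 := by positivity
  rw [h2]
  have h7 : 2 * a * (B2 a r * (|r| * |y|)) ≤ B2 a r * (|r| * |y|) :=
    mul_le_of_le_one_left h5 (by linarith)
  nlinarith [abs_nonneg r]

/-- growth control near the boundary of the cutoff -/
lemma cut_growth {q : ℝ} (hq1 : 1 < q) (hq2 : q < 2) : ∃ j : ℕ, ∀ ω r : ℝ, 0 ≤ ω → ω ≤ 1 →
    ω ^ (j + 1) * |r| ^ (q - 1) ≤ 2 + ω ^ (j + 2) * QQ (q / 4) r := by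
  set θ := 2 * (q - 1) / q with hθ
  have hθ0 : 0 < θ := by rw [hθ]; apply div_pos <;> linarith
  have hθ1 : θ < 1 := by rw [hθ, div_lt_one (by linarith)]; linarith
  obtain ⟨j, hj⟩ := exists_nat_ge (1 / (1 - θ))
  refine ⟨j, fun ω r h0 h1 => ?_⟩
  have hj' : ((j + 2 : ℕ) : ℝ) * θ ≤ ((j + 1 : ℕ) : ℝ) := by
    rw [div_le_iff₀ (by linarith)] at hj
    push_cast
    nlinarith
  have hQ0 := QQ_nonneg (a := q / 4) (by linarith) r
  have hω2 : ω ^ (j + 2) ≤ 1 := pow_le_one₀ h0 h1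
  have hω2' : 0 ≤ ω ^ (j + 2) := by positivity
  have hr : |r| ^ (q - 1) ≤ (1 + QQ (q / 4) r) ^ θ := by
    have e1 : 1 + QQ (q / 4) r = (1 + r ^ 2) ^ (q / 4) := by unfold QQ; ring
    rw [e1, ← Real.rpow_mul (by positivity)]
    have e2 : q / 4 * θ = (q - 1) / 2 := by rw [hθ]; field_simp; ring
    rw [e2]
    have e3 : |r| ^ (q - 1) = (r ^ 2) ^ ((q - 1) / 2) := by
      rw [← sq_abs, ← Real.rpow_natCast, ← Real.rpow_mul (abs_nonneg r)]
      congr 1; push_cast; ring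
    rw [e3]
    exact Real.rpow_le_rpow (sq_nonneg r) (by linarith) (by linarith)
  have hw : ω ^ (j + 1) ≤ (ω ^ (j + 2)) ^ θ := by
    rcases h0.eq_or_lt with rfl | hpos
    · rw [zero_pow (by omega), zero_pow (by omega), Real.zero_rpow hθ0.ne']
    · rw [← Real.rpow_natCast, ← Real.rpow_natCast, ← Real.rpow_mul h0]
      exact Real.rpow_le_rpow_of_exponent_ge hpos h1 hj'
  calc ω ^ (j + 1) * |r| ^ (q - 1) ≤ (ω ^ (j + 2)) ^ θ * (1 + QQ (q / 4) r) ^ θ := by gcongr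
    _ = (ω ^ (j + 2) * (1 + QQ (q / 4) r)) ^ θ := (Real.mul_rpow hω2' (by linarith)).symm
    _ ≤ (1 + ω ^ (j + 2) * (1 + QQ (q / 4) r)) ^ θ :=
        Real.rpow_le_rpow (by positivity) (by linarith) hθ0.le
    _ ≤ (1 + ω ^ (j + 2) * (1 + QQ (q / 4) r)) ^ (1:ℝ) :=
        Real.rpow_le_rpow_of_exponent_le (by nlinarith) hθ1.le
    _ ≤ _ := by rw [Real.rpow_one]; nlinarith

lemma inner_growth {q : ℝ} (hq1 : 1 < q) (hq2 : q < 2) {ψ r : ℝ} (h0 : 0 ≤ ψ) (h1 : ψ ≤ 1) :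
    ψ * ((|r| + 1) ^ (q - 1)) ^ 2 ≤ 2 * (1 + |r|) * (1 + ψ * QQ (q / 4) r) := by
  have hr := abs_nonneg r
  have a1 : (|r| + 1) ^ (q - 1) ≤ 1 + |r| := by
    calc (|r| + 1) ^ (q - 1) ≤ (|r| + 1) ^ (1:ℝ) :=
          Real.rpow_le_rpow_of_exponent_le (by linarith) (by linarith)
      _ = _ := by rw [Real.rpow_one]; ring
  have a2 : (|r| + 1) ^ (q - 1) ≤ 2 * (1 + QQ (q / 4) r) := by
    have e1 : 1 + QQ (q / 4) r = (1 + r ^ 2) ^ (q / 4) := by unfold QQ; ring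
    rw [e1]
    have e3 : (|r| + 1) ^ (q - 1) = ((|r| + 1) ^ 2) ^ ((q - 1) / 2) := by
      rw [← Real.rpow_natCast, ← Real.rpow_mul (by positivity)]
      congr 1; push_cast; ring
    rw [e3]
    calc ((|r| + 1) ^ 2) ^ ((q - 1) / 2) ≤ (2 * (1 + r ^ 2)) ^ ((q - 1) / 2) := by
          apply Real.rpow_le_rpow (by positivity) _ (by linarith)
          nlinarith [sq_abs r, sq_nonneg (|r| - 1)]
      _ = 2 ^ ((q - 1) / 2) * (1 + r ^ 2) ^ ((q - 1) / 2) := Real.mul_rpow (by norm_num) (by positivity)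
      _ ≤ 2 ^ (1:ℝ) * (1 + r ^ 2) ^ (q / 4) := by
          exact mul_le_mul (Real.rpow_le_rpow_of_exponent_le (by norm_num) (by linarith))
            (Real.rpow_le_rpow_of_exponent_le (one_le_sq r) (by linarith)) (by positivity) (by positivity)
      _ = _ := by rw [Real.rpow_one]
  have hQ := QQ_nonneg (a := q / 4) (by linarith) r
  have a0 : 0 ≤ (|r| + 1) ^ (q - 1) := by positivity
  calc ψ * ((|r| + 1) ^ (q - 1)) ^ 2 = ψ * ((|r| + 1) ^ (q - 1) * (|r| + 1) ^ (q - 1)) := by ring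
    _ ≤ ψ * ((1 + |r|) * (2 * (1 + QQ (q / 4) r))) := by gcongr
    _ = 2 * (1 + |r|) * (ψ + ψ * QQ (q / 4) r) := by ring
    _ ≤ _ := by gcongr

/-- cutoff function -/
noncomputable def om (L x : ℝ) : ℝ := 1 - (x / L) ^ 2
noncomputable def ps (j : ℕ) (L x : ℝ) : ℝ := om L x ^ (j + 2)
noncomputable def ps1 (j : ℕ) (L x : ℝ) : ℝ := (j + 2) * om L x ^ (j + 1) * (-2 * x / L ^ 2)
noncomputable def ps2 (j : ℕ) (L x : ℝ) : ℝ :=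
  (j + 2) * ((j + 1) * om L x ^ j * (-2 * x / L ^ 2)) * (-2 * x / L ^ 2)
    + (j + 2) * om L x ^ (j + 1) * (-2 / L ^ 2)

structure Cut (q L A : ℝ) (ψ ψ1 ψ2 : ℝ → ℝ) : Prop where
  d1 : ∀ x, HasDerivAt ψ (ψ1 x) x
  d2 : ∀ x, HasDerivAt ψ1 (ψ2 x) x
  c2 : Continuous ψ2
  z0 : ψ L = 0
  z0' : ψ (-L) = 0
  z1 : ψ1 L = 0
  z1' : ψ1 (-L) = 0
  nn : ∀ x ∈ Icc (-L) L, 0 ≤ ψ x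
  le : ∀ x ∈ Icc (-L) L, ψ x ≤ 1
  b1 : ∀ x ∈ Icc (-L) L, |ψ1 x| ≤ A / L
  b2 : ∀ x ∈ Icc (-L) L, |ψ2 x| ≤ A / L
  gr : ∀ x ∈ Icc (-L) L, ∀ r, |ψ1 x| * |r| ^ (q - 1) ≤ A / L * (2 + ψ x * QQ (q / 4) r)

lemma om_deriv (L x : ℝ) : HasDerivAt (om L) (-2 * x / L ^ 2) x := by
  have := (((hasDerivAt_id x).div_const L).pow 2).const_sub 1
  refine this.congr_deriv ?_
  simp; ring

lemma om_mem {L x : ℝ} (hL : 1 ≤ L) (hx : x ∈ Icc (-L) L) : 0 ≤ om L x ∧ om L x ≤ 1 := by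
  have : (x / L) ^ 2 ≤ 1 := by
    rw [sq_le_one_iff_abs_le_one, abs_div, abs_of_pos (by linarith : 0 < L), div_le_one (by linarith)]
    exact abs_le.2 hx
  unfold om
  constructor <;> nlinarith [sq_nonneg (x / L)]

lemma exists_cut {q : ℝ} (hq1 : 1 < q) (hq2 : q < 2) : ∃ (j : ℕ) (A : ℝ), 0 ≤ A ∧ ∀ L, 1 ≤ L →
    Cut q L A (ps j L) (ps1 j L) (ps2 j L) := by
  obtain ⟨j, hj⟩ := cut_growth hq1 hq2
  refine ⟨j, (j + 2) * (j + 1) * 4 + (j + 2) * 2, by positivity, fun L hL => ?_⟩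
  have hL0 : 0 < L := by linarith
  have oc : Continuous (om L) := continuous_iff_continuousAt.2 fun x => (om_deriv L x).continuousAt
  have omL : om L L = 0 := by unfold om; field_simp; ring
  have omL' : om L (-L) = 0 := by unfold om; field_simp; ring
  have hlin : ∀ x ∈ Icc (-L) L, |-2 * x / L ^ 2| ≤ 2 / L := by
    intro x hx
    rw [abs_div, abs_mul, abs_of_pos (by positivity : 0 < L ^ 2), div_le_div_iff₀ (by positivity) hL0]
    have : |x| ≤ L := abs_le.2 hx
    simp only [abs_neg, Nat.abs_ofNat]
    nlinarith
  have hps1 : ∀ x ∈ Icc (-L) L, |ps1 j L x| ≤ (j + 2) * 2 / L * om L x ^ (j + 1) := by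
    intro x hx
    obtain ⟨o0, o1⟩ := om_mem hL hx
    unfold ps1
    rw [abs_mul, abs_of_nonneg (by positivity : 0 ≤ ((j:ℝ) + 2) * om L x ^ (j + 1))]
    calc _ ≤ ((j:ℝ) + 2) * om L x ^ (j + 1) * (2 / L) := by gcongr; exact hlin x hx
      _ = _ := by ring
  have hA : ((j:ℝ) + 2) * 2 / L ≤ ((j + 2) * (j + 1) * 4 + (j + 2) * 2) / L := by
    gcongr
    have : (0:ℝ) ≤ (j + 2) * (j + 1) * 4 := by positivity
    linarith
  refine ⟨?_, ?_, ?_, ?_, ?_, ?_, ?_, ?_, ?_, ?_, ?_, ?_⟩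
  · intro x
    refine ((om_deriv L x).pow (j + 2)).congr_deriv ?_
    unfold ps1; push_cast; simp
  · intro x
    have h1 := ((om_deriv L x).pow (j + 1)).const_mul ((j:ℝ) + 2)
    have h2 : HasDerivAt (fun x : ℝ => -2 * x / L ^ 2) (-2 / L ^ 2) x := by
      have := ((hasDerivAt_id x).const_mul (-2:ℝ)).div_const (L ^ 2)
      refine this.congr_deriv ?_
      simp
    refine (h1.mul h2).congr_deriv ?_
    unfold ps2; push_cast; simp
  · unfold ps2; fun_prop
  · simp [ps, omL]
  · simp [ps, omL']
  · simp [ps1, omL]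
  · simp [ps1, omL']
  · intro x hx; exact pow_nonneg (om_mem hL hx).1 _
  · intro x hx; exact pow_le_one₀ (om_mem hL hx).1 (om_mem hL hx).2
  · intro x hx
    refine (hps1 x hx).trans (le_trans ?_ hA)
    exact mul_le_of_le_one_right (by positivity) (pow_le_one₀ (om_mem hL hx).1 (om_mem hL hx).2)
  · intro x hx
    obtain ⟨o0, o1⟩ := om_mem hL hx
    have p0 : om L x ^ j ≤ 1 := pow_le_one₀ o0 o1
    have p1 : om L x ^ (j + 1) ≤ 1 := pow_le_one₀ o0 o1
    have hl := hlin x hx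
    have hL2 : 2 / L ^ 2 ≤ 2 / L := by
      gcongr; nlinarith
    have hl2 : (2 / L) * (2 / L) ≤ 4 / L := by
      rw [div_mul_div_comm, div_le_div_iff₀ (by positivity) hL0]; nlinarith
    unfold ps2
    refine (abs_add_le _ _).trans ?_
    have h3 : |-2 / L ^ 2| = 2 / L ^ 2 := by
      rw [abs_div, abs_of_pos (by positivity : 0 < L ^ 2)]; simp
    have k2 : |(j:ℝ) + 2| = j + 2 := abs_of_nonneg (by positivity)
    have k1 : |(j:ℝ) + 1| = j + 1 := abs_of_nonneg (by positivity)
    have k3 : |om L x ^ j| = om L x ^ j := abs_of_nonneg (by positivity)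
    have k4 : |om L x ^ (j + 1)| = om L x ^ (j + 1) := abs_of_nonneg (by positivity)
    have m1 : |((j:ℝ) + 2) * ((j + 1) * om L x ^ j * (-2 * x / L ^ 2)) * (-2 * x / L ^ 2)|
        = (j + 2) * ((j + 1) * om L x ^ j * |-2 * x / L ^ 2|) * |-2 * x / L ^ 2| := by
      rw [abs_mul, abs_mul ((j:ℝ) + 2), abs_mul (((j:ℝ) + 1) * om L x ^ j), abs_mul ((j:ℝ) + 1),
        k1, k2, k3]
    have m2 : |((j:ℝ) + 2) * om L x ^ (j + 1) * (-2 / L ^ 2)|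
        = (j + 2) * om L x ^ (j + 1) * (2 / L ^ 2) := by
      rw [abs_mul, abs_mul ((j:ℝ) + 2), k2, k4, h3]
    rw [m1, m2]
    calc _ ≤ ((j:ℝ) + 2) * ((j + 1) * 1 * (2 / L)) * (2 / L) + (j + 2) * 1 * (2 / L) := by gcongr
      _ = ((j:ℝ) + 2) * (j + 1) * ((2 / L) * (2 / L)) + (j + 2) * 2 / L := by ring
      _ ≤ ((j:ℝ) + 2) * (j + 1) * (4 / L) + (j + 2) * 2 / L := by gcongr
      _ = _ := by ring
  · intro x hx r
    obtain ⟨o0, o1⟩ := om_mem hL hx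
    have h1 := hj (om L x) r o0 o1
    have h0 : 0 ≤ 2 + ps j L x * QQ (q / 4) r := by
      have := QQ_nonneg (a := q / 4) (by linarith) r
      have : 0 ≤ ps j L x := pow_nonneg o0 _
      positivity
    calc |ps1 j L x| * |r| ^ (q - 1) ≤ ((j + 2) * 2 / L * om L x ^ (j + 1)) * |r| ^ (q - 1) := by
          gcongr; exact hps1 x hx
      _ = (j + 2) * 2 / L * (om L x ^ (j + 1) * |r| ^ (q - 1)) := by ring
      _ ≤ (j + 2) * 2 / L * (2 + ps j L x * QQ (q / 4) r) := by gcongr; exact h1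
      _ ≤ _ := by gcongr

lemma ps_tendsto (j : ℕ) (x : ℝ) : Tendsto (fun L => ps j L x) atTop (𝓝 1) := by
  have h1 : Tendsto (fun L : ℝ => x / L) atTop (𝓝 0) := tendsto_const_nhds.div_atTop tendsto_id
  have := ((h1.pow 2).const_sub 1).pow (j + 2)
  simpa [ps, om] using this

end RegSol

namespace RegSol
open Set Topology

lemma Cut.c0 {q L A ψ ψ1 ψ2} (h : Cut q L A ψ ψ1 ψ2) : Continuous ψ :=
  continuous_iff_continuousAt.2 fun z => (h.d1 z).continuousAt

lemma Cut.c1 {q L A ψ ψ1 ψ2} (h : Cut q L A ψ ψ1 ψ2) : Continuous ψ1 :=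
  continuous_iff_continuousAt.2 fun z => (h.d2 z).continuousAt

/-- dissipation -/
noncomputable def Dis (q L : ℝ) (ψ f : ℝ → ℝ) : ℝ :=
  ∫ x in Icc (-L) L, ψ x * (B2 (q / 4) (f x) * deriv f x ^ 2)

lemma Dis_nonneg {q L A ψ ψ1 ψ2} (h : Cut q L A ψ ψ1 ψ2) (f : ℝ → ℝ) : 0 ≤ Dis q L ψ f :=
  setIntegral_nonneg measurableSet_Icc fun x hx =>
    mul_nonneg (h.nn x hx) (mul_nonneg (B2_pos _ _).le (sq_nonneg _))

lemma s_bound {q L A G : ℝ} {ψ ψ1 ψ2 f : ℝ → ℝ} (hq1 : 1 < q) (hq2 : q < 2)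
    (h : Cut q L A ψ ψ1 ψ2) (hL : 1 ≤ L) (hA : 0 ≤ A) (hf : ContDiff ℝ 2 f) (hi : Integrable f)
    (hG : ∫ x, |f x| ≤ G) :
    ∀ x ∈ Icc (-L) L, ψ x * QQ (q / 4) (f x) ≤ (A + 1) * G + Dis q L ψ f := by
  intro x hx
  set a := q / 4 with ha
  have ha0 : 0 ≤ a := by rw [ha]; linarith
  have ha1 : a ≤ 1 / 2 := by rw [ha]; linarith
  have c0 := c2_c0 hf
  have c1 := c2_c1 hf
  have k0 := h.c0
  have k1 := h.c1
  have cB : Continuous (fun x => B2 a (f x)) := (B2_cont a).comp c0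
  have hQc : Continuous (QQ a) := continuous_iff_continuousAt.2 fun z => (QQ_deriv a z).continuousAt
  have cQ : Continuous (fun x => QQ a (f x)) := hQc.comp c0
  have hd : ∀ x, HasDerivAt (fun x => ψ x * QQ a (f x))
      (ψ1 x * QQ a (f x) + ψ x * (2 * a * f x * B2 a (f x) * deriv f x)) x := fun x =>
    (h.d1 x).mul ((QQ_deriv a (f x)).comp x (c2_d1 hf x))
  have hc : Continuous (fun x => ψ1 x * QQ a (f x) + ψ x * (2 * a * f x * B2 a (f x) * deriv f x)) := by
    fun_prop
  have e1 := intervalIntegral.integral_eq_sub_of_hasDerivAt (a := -L) (b := x) (fun y _ => hd y)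
    (hc.intervalIntegrable _ _)
  rw [h.z0', zero_mul, sub_zero, intervalIntegral.integral_of_le hx.1,
    ← integral_Icc_eq_integral_Ioc] at e1
  rw [← e1]
  set g : ℝ → ℝ := fun x => (A + 1) * |f x| + ψ x * (B2 a (f x) * deriv f x ^ 2) with hg
  have hgc : Continuous g := by rw [hg]; fun_prop
  have hsub : Icc (-L) x ⊆ Icc (-L) L := Icc_subset_Icc le_rfl hx.2
  have hpt : ∀ y ∈ Icc (-L) x, ψ1 y * QQ a (f y) + ψ y * (2 * a * f y * B2 a (f y) * deriv f y) ≤ g y := by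
    intro y hy
    have hy' := hsub hy
    have p0 := h.nn y hy'
    have p1 := h.le y hy'
    have b1 : |ψ1 y| ≤ A := (h.b1 y hy').trans (div_le_self hA hL)
    have t1 : ψ1 y * QQ a (f y) ≤ A * |f y| :=
      mul_le_mul ((le_abs_self _).trans b1) (QQ_le ha1 _) (QQ_nonneg ha0 _) hA
    have t2 := (le_abs_self _).trans (QQ'_le ha0 ha1 (f y) (deriv f y))
    have t3 := mul_le_mul_of_nonneg_left t2 p0
    have t4 : ψ y * |f y| ≤ |f y| := mul_le_of_le_one_left (abs_nonneg _) p1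
    simp only [hg]
    linarith
  have hg0 : ∀ y ∈ Icc (-L) L, 0 ≤ g y := fun y hy => by
    have p0 := h.nn y hy
    have := (B2_pos a (f y)).le
    simp only [hg]; positivity
  calc _ ≤ ∫ y in Icc (-L) x, g y :=
        setIntegral_mono_on hc.integrableOn_Icc hgc.integrableOn_Icc measurableSet_Icc hpt
    _ ≤ ∫ y in Icc (-L) L, g y := by
        refine setIntegral_mono_set hgc.integrableOn_Icc ?_ hsub.eventuallyLE
        exact (ae_restrict_iff' measurableSet_Icc).2 (Eventually.of_forall hg0)
    _ = (A + 1) * (∫ y in Icc (-L) L, |f y|) + Dis q L ψ f := by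
        rw [hg, integral_add (Continuous.integrableOn_Icc (by fun_prop))
          (Continuous.integrableOn_Icc (by fun_prop)), integral_const_mul]
        rfl
    _ ≤ _ := by
        have := (setInt_abs_le hi (Icc (-L) L)).trans hG
        gcongr

variable {J : ℝ → ℝ} {q α μ : ℝ}

set_option maxHeartbeats 1000000 in
lemma row2 {u : ℝ → ℝ → ℝ} (h : Sol J q α μ u) (h0 : ∀ x, 0 ≤ J x) (hJ : Integrable J)
    (hm : ∫ x, J x = 1) (hq1 : 1 < q) (hq2 : q < 2) (hα : 0 < α) (hμ : 0 < μ)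
    {s L A G C S : ℝ} {ψ ψ1 ψ2 : ℝ → ℝ} (hs : 0 < s) (K : Cut q L A ψ ψ1 ψ2) (hL : 1 ≤ L) (hA : 0 ≤ A)
    (hG : ∫ x, |u s x| ≤ G) (hC0 : 0 ≤ C) (hC : ∀ r, |B1 (q / 4) r| ≤ C)
    (hS : ∀ x ∈ Icc (-L) L, ψ x * QQ (q / 4) (u s x) ≤ S) (hS0 : 0 ≤ S) :
    IntegrableOn (fun x => ψ x * (B1 (q / 4) (u s x) * dt u s x)) (Icc (-L) L) ∧
    ∫ x in Icc (-L) L, ψ x * (B1 (q / 4) (u s x) * dt u s x) ≤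
      - (μ * Dis q L ψ (u s)) + (μ * (A / L) * C + C * (A / L) * (2 + S)) * G + α * C * (2 * G) := by
  set a := q / 4 with ha
  set e := q - 1 with he
  have he0 : 0 < e := by linarith
  have hf := h.c2 s hs
  have hfInt := h.int s hs.le
  set f := u s with hfdef
  have hR : 0 ≤ L := by linarith
  have c0 := c2_c0 hf
  have c1 := c2_c1 hf
  have c2 := c2_c2 hf
  have k0 := K.c0
  have k1 := K.c1
  have k2 := K.c2
  have cB2 : Continuous (fun x => B2 a (f x)) := (B2_cont a).comp c0
  have cB1 : Continuous (fun x => B1 a (f x)) := (B1_cont a).comp c0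
  have cB0 : Continuous (fun x => B0 a (f x)) := (Prim_continuous (B1_cont a)).comp c0
  have cQ : Continuous (fun x => Qh a e (f x)) := (Prim_continuous (Qh_cont a he0)).comp c0
  have cf : Continuous (fun x => |f x| ^ e) := (absrpow_cont he0).comp c0
  have dB1 : ∀ x, HasDerivAt (fun x => B1 a (f x)) (B2 a (f x) * deriv f x) x := fun x =>
    (Prim_hasDerivAt (B2_cont a) (f x)).comp x (c2_d1 hf x)
  have dB0 : ∀ x, HasDerivAt (fun x => B0 a (f x)) (B1 a (f x) * deriv f x) x := fun x =>
    (Prim_hasDerivAt (B1_cont a) (f x)).comp x (c2_d1 hf x)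
  have dQ : ∀ x, HasDerivAt (fun x => Qh a e (f x)) (B1 a (f x) * |f x| ^ e * deriv f x) x := fun x =>
    (Prim_hasDerivAt (Qh_cont a he0) (f x)).comp x (c2_d1 hf x)
  set Y : ℝ → ℝ := fun x => μ * (ψ x * B1 a (f x) * deriv f x) - μ * (ψ1 x * B0 a (f x))
    - ψ x * Qh a e (f x) with hY
  set Y' : ℝ → ℝ := fun x => μ * ((ψ1 x * B1 a (f x) + ψ x * (B2 a (f x) * deriv f x)) * deriv f x
      + ψ x * B1 a (f x) * deriv (deriv f) x) - μ * (ψ2 x * B0 a (f x) + ψ1 x * (B1 a (f x) * deriv f x))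
    - (ψ1 x * Qh a e (f x) + ψ x * (B1 a (f x) * |f x| ^ e * deriv f x)) with hY'
  have hYd : ∀ x, HasDerivAt Y (Y' x) x := fun x =>
    (((((K.d1 x).mul (dB1 x)).mul (c2_d2 hf x)).const_mul μ).sub
      (((K.d2 x).mul (dB0 x)).const_mul μ)).sub ((K.d1 x).mul (dQ x))
  have hY'c : Continuous Y' := by rw [hY']; fun_prop
  have hYint := ftc_zero hR hYd hY'c (by simp [hY, K.z0, K.z1]) (by simp [hY, K.z0', K.z1'])
  set Z : ℝ → ℝ := fun x => ψ x * (B2 a (f x) * deriv f x ^ 2) with hZ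
  have hZc : Continuous Z := by rw [hZ]; fun_prop
  set c3 := μ * (A / L) * C + C * (A / L) * (2 + S) with hc3
  have hAL : 0 ≤ A / L := by positivity
  have hpt : ∀ x ∈ Icc (-L) L, ψ x * (B1 a (f x) * dt u s x) ≤
      (Y' x - μ * Z x) + (c3 * |f x| + α * C * (|cv J f x| + |f x|)) := by
    intro x hx
    have p0 := K.nn x hx
    have p1 := K.le x hx
    rw [h.pde s hs x]
    have t1 : μ * (ψ2 x * B0 a (f x)) ≤ μ * ((A / L) * (C * |f x|)) := by
      refine mul_le_mul_of_nonneg_left ?_ hμ.le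
      refine (le_abs_self _).trans ?_
      rw [abs_mul]
      exact mul_le_mul (K.b2 x hx) (B0_bound hC _) (abs_nonneg _) hAL
    have t2 : ψ1 x * Qh a e (f x) ≤ C * (A / L * (2 + S)) * |f x| := by
      refine (le_abs_self _).trans ?_
      rw [abs_mul]
      calc |ψ1 x| * |Qh a e (f x)| ≤ |ψ1 x| * (C * |f x| ^ e * |f x|) := by
            gcongr; exact Qh_bound he0 hC _
        _ = C * (|ψ1 x| * |f x| ^ e) * |f x| := by ring
        _ ≤ C * (A / L * (2 + ψ x * QQ a (f x))) * |f x| := by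
            exact mul_le_mul_of_nonneg_right (mul_le_mul_of_nonneg_left (K.gr x hx (f x)) hC0)
              (abs_nonneg _)
        _ ≤ _ := by
            gcongr; exact hS x hx
    have t3 : ψ x * (B1 a (f x) * (cv J f x - f x)) ≤ C * (|cv J f x| + |f x|) := by
      refine pmul_le p0 p1 ?_ (by positivity)
      refine (le_abs_self _).trans ?_
      rw [abs_mul]
      exact mul_le_mul (hC _) (abs_sub _ _) (abs_nonneg _) hC0
    have t4 := mul_le_mul_of_nonneg_left t3 hα.le
    simp only [hY', hc3, hZ]
    linear_combination t1 + t2 + t4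
  have hi1 : IntegrableOn (fun x => ψ x * (B1 a (f x) * dt u s x)) (Icc (-L) L) := by
    have h1 := h.dt_int hq1 hJ hs (-L) L
    have h2 : IntegrableOn (fun x => (ψ x * B1 a (f x)) * dt u s x) (Icc (-L) L) := by
      refine Integrable.bdd_mul (c := C) h1 (k0.mul cB1).aestronglyMeasurable ?_
      refine (ae_restrict_iff' measurableSet_Icc).2 (Eventually.of_forall fun x hx => ?_)
      rw [Real.norm_eq_abs, abs_mul, abs_of_nonneg (K.nn x hx)]
      exact pmul_le (K.nn x hx) (K.le x hx) (hC _) hC0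
    refine h2.congr (Eventually.of_forall fun x => ?_)
    simp only; ring
  refine ⟨hi1, ?_⟩
  have hcv := cv_integrable hJ hfInt
  have i1 : IntegrableOn (fun x => Y' x - μ * Z x) (Icc (-L) L) :=
    Continuous.integrableOn_Icc (by fun_prop)
  have i2 : IntegrableOn (fun x => c3 * |f x|) (Icc (-L) L) := (hfInt.abs.const_mul c3).integrableOn
  have i3 : IntegrableOn (fun x => α * C * (|cv J f x| + |f x|)) (Icc (-L) L) :=
    ((hcv.abs.add hfInt.abs).const_mul (α * C)).integrableOn
  have i4 : IntegrableOn (fun x => c3 * |f x| + α * C * (|cv J f x| + |f x|)) (Icc (-L) L) := i2.add i3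
  calc _ ≤ ∫ x in Icc (-L) L, ((Y' x - μ * Z x) + (c3 * |f x| + α * C * (|cv J f x| + |f x|))) :=
        setIntegral_mono_on hi1 (i1.add i4) measurableSet_Icc hpt
    _ = - (μ * Dis q L ψ f) + c3 * (∫ x in Icc (-L) L, |f x|) +
        α * C * ((∫ x in Icc (-L) L, |cv J f x|) + ∫ x in Icc (-L) L, |f x|) := by
        rw [integral_add i1 i4, integral_sub hY'c.integrableOn_Icc
          (Continuous.integrableOn_Icc (by fun_prop)), hYint, integral_add i2 i3, integral_const_mul,
          integral_const_mul, integral_const_mul,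
          integral_add hcv.abs.integrableOn hfInt.abs.integrableOn]
        simp only [Dis, hZ, ← ha]
        ring
    _ ≤ _ := by
        have a1 := (setInt_abs_le hcv (Icc (-L) L)).trans ((cv_abs_le h0 hJ hm hfInt).trans hG)
        have a2 := (setInt_abs_le hfInt (Icc (-L) L)).trans hG
        have : 0 ≤ c3 := by positivity
        gcongr
        linarith

set_option maxHeartbeats 1000000 in
lemma row1 {u v : ℝ → ℝ → ℝ} (hu : Sol J q α μ u) (hv : Sol J q α μ v)
    (h0 : ∀ x, 0 ≤ J x) (hJ : Integrable J)
    (hm : ∫ x, J x = 1) (hq1 : 1 < q) (hq2 : q < 2) (hα : 0 < α) (hμ : 0 < μ)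
    {s L A G S M δ C0 : ℝ} {ψ ψ1 ψ2 β p r : ℝ → ℝ} (hs : 0 < s) (K : Cut q L A ψ ψ1 ψ2)
    (hL : 1 ≤ L) (hA : 0 ≤ A) (hδ : 0 < δ) (hδ1 : δ ≤ 1) (hC0 : 0 ≤ C0) (B : Beta δ C0 β p r)
    (hGu : ∫ x, |u s x| ≤ G) (hGv : ∫ x, |v s x| ≤ G) (hM : ∫ x, max (u s x - v s x) 0 ≤ M)
    (hSu : ∀ x ∈ Icc (-L) L, ψ x * QQ (q / 4) (u s x) ≤ S)
    (hSv : ∀ x ∈ Icc (-L) L, ψ x * QQ (q / 4) (v s x) ≤ S) (hS0 : 0 ≤ S) :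
    IntegrableOn (fun x => ψ x * (p (u s x - v s x) * (dt u s x - dt v s x))) (Icc (-L) L) ∧
    ∫ x in Icc (-L) L, ψ x * (p (u s x - v s x) * (dt u s x - dt v s x)) ≤
      α * M + (μ * (A / L) + A / L * (2 + S)) * (2 * G)
        + C0 * δ / (2 * μ) * (1 + S) * (2 * L + G) := by
  set a := q / 4 with ha
  set e := q - 1 with he
  have he0 : 0 < e := by linarith
  have hf := hu.c2 s hs
  have hg := hv.c2 s hs
  have hfi := hu.int s hs.le
  have hgi := hv.int s hs.le
  set f := u s with hfdef
  set g := v s with hgdef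
  have hR : 0 ≤ L := by linarith
  set ΔF : ℝ → ℝ := fun x => FF e (f x) - FF e (g x) with hΔF
  have hzd : ∀ x, HasDerivAt (fun x => f x - g x) (deriv f x - deriv g x) x := fun x =>
    (c2_d1 hf x).sub (c2_d1 hg x)
  have hFd : ∀ x, HasDerivAt ΔF (|f x| ^ e * deriv f x - |g x| ^ e * deriv g x) x := fun x =>
    ((FF_hasDerivAt he0 (f x)).comp x (c2_d1 hf x)).sub
      ((FF_hasDerivAt he0 (g x)).comp x (c2_d1 hg x))
  have hpd : ∀ x, HasDerivAt (fun x => p (f x - g x))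
      (r (f x - g x) * (deriv f x - deriv g x)) x := fun x => (B.hp (f x - g x)).comp x (hzd x)
  have hβd : ∀ x, HasDerivAt (fun x => β (f x - g x))
      (p (f x - g x) * (deriv f x - deriv g x)) x := fun x => (B.hβ (f x - g x)).comp x (hzd x)
  have c0 := c2_c0 hf
  have c1 := c2_c1 hf
  have c2 := c2_c2 hf
  have d0 := c2_c0 hg
  have d1 := c2_c1 hg
  have d2 := c2_c2 hg
  have k0 := K.c0
  have k1 := K.c1
  have k2 := K.c2
  have cz : Continuous (fun x => f x - g x) := by fun_prop
  have cp : Continuous (fun x => p (f x - g x)) := B.pc.comp cz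
  have cr : Continuous (fun x => r (f x - g x)) := B.hr.comp cz
  have cb : Continuous (fun x => β (f x - g x)) := B.βc.comp cz
  have cF : Continuous ΔF := continuous_iff_continuousAt.2 fun x => (hFd x).continuousAt
  have cf : Continuous (fun x => |f x| ^ e) := (absrpow_cont he0).comp c0
  have cg : Continuous (fun x => |g x| ^ e) := (absrpow_cont he0).comp d0
  set Y : ℝ → ℝ := fun x => μ * (ψ x * p (f x - g x) * (deriv f x - deriv g x))
    - μ * (ψ1 x * β (f x - g x)) - ψ x * p (f x - g x) * ΔF x with hY
  set Y' : ℝ → ℝ := fun x => μ * ((ψ1 x * p (f x - g x) + ψ x * (r (f x - g x) * (deriv f x - deriv g x)))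
        * (deriv f x - deriv g x) + ψ x * p (f x - g x) * (deriv (deriv f) x - deriv (deriv g) x))
    - μ * (ψ2 x * β (f x - g x) + ψ1 x * (p (f x - g x) * (deriv f x - deriv g x)))
    - ((ψ1 x * p (f x - g x) + ψ x * (r (f x - g x) * (deriv f x - deriv g x))) * ΔF x
      + ψ x * p (f x - g x) * (|f x| ^ e * deriv f x - |g x| ^ e * deriv g x)) with hY'
  have hYd : ∀ x, HasDerivAt Y (Y' x) x := fun x =>
    (((((K.d1 x).mul (hpd x)).mul ((c2_d2 hf x).sub (c2_d2 hg x))).const_mul μ).sub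
      (((K.d2 x).mul (hβd x)).const_mul μ)).sub (((K.d1 x).mul (hpd x)).mul (hFd x))
  have hY'c : Continuous Y' :=
    ((continuous_const.mul ((((k1.mul cp).add (k0.mul (cr.mul (c1.sub d1)))).mul (c1.sub d1)).add
      ((k0.mul cp).mul (c2.sub d2)))).sub (continuous_const.mul ((k2.mul cb).add
      (k1.mul (cp.mul (c1.sub d1)))))).sub ((((k1.mul cp).add (k0.mul (cr.mul (c1.sub d1)))).mul cF).add
      ((k0.mul cp).mul ((cf.mul c1).sub (cg.mul d1))))
  have hYint := ftc_zero hR hYd hY'c (by simp [hY, K.z0, K.z1]) (by simp [hY, K.z0', K.z1'])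
  have hAL : 0 ≤ A / L := by positivity
  set c3 := μ * (A / L) + A / L * (2 + S) with hc3
  set c4 := C0 * δ / (2 * μ) * (1 + S) with hc4
  have hc40 : 0 ≤ c4 := by positivity
  have hc30 : 0 ≤ c3 := by positivity
  set W : ℝ → ℝ := fun y => max (f y - g y) 0 with hW
  have hWi : Integrable W := (hfi.sub hgi).pos_part
  have hW0 : ∀ x, 0 ≤ W x := fun x => le_max_right _ _
  have hpt : ∀ x ∈ Icc (-L) L, cv J f x - cv J g x ≤ cv J W x →
      ψ x * (p (f x - g x) * (dt u s x - dt v s x)) ≤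
      Y' x + (α * cv J W x + (c3 * (|f x| + |g x|) + c4 * (1 + |f x|))) := by
    intro x hx hcvx
    have p0 := K.nn x hx
    have p1 := K.le x hx
    rw [hu.pde s hs x, hv.pde s hs x]
    have hp0 := B.p0 (f x - g x)
    have hp1 := B.p1 (f x - g x)
    have hr0 := B.r0 (f x - g x)
    have hX : r (f x - g x) * (ΔF x) ^ 2 ≤ C0 * δ * ((|f x| + 1) ^ e) ^ 2 := by
      by_cases hr : r (f x - g x) = 0
      · rw [hr, zero_mul]; positivity
      · obtain ⟨z0, z1⟩ := B.rs _ hr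
        have hgb : |g x| ≤ |f x| + 1 := by
          have : g x = f x - (f x - g x) := by ring
          rw [this]
          refine (abs_sub _ _).trans ?_
          rw [abs_of_nonneg z0]; linarith
        have hF := FF_sub_le he0 hgb (by linarith : |f x| ≤ |f x| + 1)
        have h1 : |f x - g x| ≤ δ := by rw [abs_of_nonneg z0]; exact z1
        have h2 : |ΔF x| ≤ (|f x| + 1) ^ e * δ := hF.trans (by gcongr)
        have h3 : (ΔF x) ^ 2 ≤ ((|f x| + 1) ^ e * δ) ^ 2 := by
          rw [← sq_abs]; gcongr
        calc r (f x - g x) * (ΔF x) ^ 2 ≤ (C0 / δ) * ((|f x| + 1) ^ e * δ) ^ 2 :=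
              mul_le_mul (B.r1 _) h3 (sq_nonneg _) (by positivity)
          _ = _ := by field_simp
    have hquad := mul_le_mul_of_nonneg_left (quad_abs (z := deriv f x - deriv g x) hμ hr0 hX) p0
    have hquad2 : ψ x * (C0 * δ * ((|f x| + 1) ^ e) ^ 2 / (4 * μ)) ≤ c4 * (1 + |f x|) := by
      have ig := inner_growth hq1 hq2 (r := f x) p0 p1
      calc ψ x * (C0 * δ * ((|f x| + 1) ^ e) ^ 2 / (4 * μ))
          = C0 * δ / (4 * μ) * (ψ x * ((|f x| + 1) ^ e) ^ 2) := by ring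
        _ ≤ C0 * δ / (4 * μ) * (2 * (1 + |f x|) * (1 + ψ x * QQ (q / 4) (f x))) := by gcongr
        _ ≤ C0 * δ / (4 * μ) * (2 * (1 + |f x|) * (1 + S)) := by
            gcongr; exact hSu x hx
        _ = _ := by rw [hc4]; field_simp; ring
    have t1 : μ * (ψ2 x * β (f x - g x)) ≤ μ * ((A / L) * (|f x| + |g x|)) := by
      refine mul_le_mul_of_nonneg_left ?_ hμ.le
      refine (le_abs_self _).trans ?_
      rw [abs_mul]
      refine mul_le_mul (K.b2 x hx) ?_ (abs_nonneg _) hAL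
      rw [abs_of_nonneg (B.β0 _)]
      refine (B.β1 _).trans (max_le ((le_abs_self _).trans (abs_sub _ _)) (by positivity))
    have t2 : ψ1 x * p (f x - g x) * ΔF x ≤ A / L * (2 + S) * (|f x| + |g x|) := by
      have gg : ∀ z, ψ x * QQ a z ≤ S → |ψ1 x| * |FF e z| ≤ A / L * (2 + S) * |z| := by
        intro z hz
        calc |ψ1 x| * |FF e z| ≤ |ψ1 x| * (|z| ^ e * |z|) := by gcongr; exact FF_abs_le he0 z
          _ = (|ψ1 x| * |z| ^ e) * |z| := by ring
          _ ≤ (A / L * (2 + ψ x * QQ a z)) * |z| :=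
              mul_le_mul_of_nonneg_right (K.gr x hx z) (abs_nonneg _)
          _ ≤ _ := by gcongr
      have g1 := gg _ (hSu x hx)
      have g2 := gg _ (hSv x hx)
      have g3 : ψ1 x * ΔF x ≤ A / L * (2 + S) * (|f x| + |g x|) := by
        refine (le_abs_self _).trans ?_
        rw [abs_mul]
        have : |ΔF x| ≤ |FF e (f x)| + |FF e (g x)| := abs_sub _ _
        have := mul_le_mul_of_nonneg_left this (abs_nonneg (ψ1 x))
        linarith
      have := pmul_le hp0 hp1 g3 (by positivity)
      linarith
    have t3 : ψ x * (p (f x - g x) * (α * (cv J f x - cv J g x - (f x - g x)))) ≤ α * cv J W x := by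
      have hcW := cv_nonneg h0 hW0 x
      have hpw : 0 ≤ p (f x - g x) * (f x - g x) := by
        rcases le_total 0 (f x - g x) with h | h
        · exact mul_nonneg hp0 h
        · rw [B.pz _ h, zero_mul]
      have a1 : p (f x - g x) * (cv J f x - cv J g x) ≤ cv J W x := pmul_le hp0 hp1 hcvx hcW
      have a2 : p (f x - g x) * (α * (cv J f x - cv J g x - (f x - g x))) ≤ α * cv J W x := by
        have := mul_le_mul_of_nonneg_left (by linarith : p (f x - g x) * (cv J f x - cv J g x)
          - p (f x - g x) * (f x - g x) ≤ cv J W x) hα.le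
        linarith
      exact pmul_le p0 p1 a2 (by positivity)
    simp only [hY', hc3]
    linear_combination t1 + t2 + t3 + hquad + hquad2
  have hi1 : IntegrableOn (fun x => ψ x * (p (f x - g x) * (dt u s x - dt v s x))) (Icc (-L) L) := by
    have h1 := (hu.dt_int hq1 hJ hs (-L) L).sub (hv.dt_int hq1 hJ hs (-L) L)
    have h2 : IntegrableOn (fun x => (ψ x * p (f x - g x)) * (dt u s x - dt v s x)) (Icc (-L) L) := by
      refine Integrable.bdd_mul (c := 1) h1 (k0.mul cp).aestronglyMeasurable ?_
      refine (ae_restrict_iff' measurableSet_Icc).2 (Eventually.of_forall fun x hx => ?_)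
      rw [Real.norm_eq_abs, abs_mul, abs_of_nonneg (K.nn x hx), abs_of_nonneg (B.p0 _)]
      exact pmul_le (K.nn x hx) (K.le x hx) (B.p1 _) zero_le_one
    refine h2.congr (Eventually.of_forall fun x => ?_)
    simp only; ring
  refine ⟨hi1, ?_⟩
  have hcv := cv_integrable hJ hWi
  have i1 : IntegrableOn Y' (Icc (-L) L) := hY'c.integrableOn_Icc
  have i2 : IntegrableOn (fun x => α * cv J W x) (Icc (-L) L) := (hcv.const_mul α).integrableOn
  have i3 : IntegrableOn (fun x => c3 * (|f x| + |g x|)) (Icc (-L) L) :=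
    ((hfi.abs.add hgi.abs).const_mul c3).integrableOn
  have i5 : IntegrableOn (fun _ : ℝ => (1:ℝ)) (Icc (-L) L) := integrableOn_const (by simp)
  have i6 : IntegrableOn (fun x => c4 * (1 + |f x|)) (Icc (-L) L) :=
    (i5.add hfi.abs.integrableOn).const_mul c4
  have i7 : IntegrableOn (fun x => c3 * (|f x| + |g x|) + c4 * (1 + |f x|)) (Icc (-L) L) := i3.add i6
  have i8 : IntegrableOn (fun x => α * cv J W x + (c3 * (|f x| + |g x|) + c4 * (1 + |f x|)))
    (Icc (-L) L) := i2.add i7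
  calc _ ≤ ∫ x in Icc (-L) L, (Y' x + (α * cv J W x + (c3 * (|f x| + |g x|) + c4 * (1 + |f x|)))) := by
        refine setIntegral_mono_on_ae hi1 (i1.add i8) measurableSet_Icc ?_
        filter_upwards [cv_sub_le h0 hJ hfi hgi] with x hx hxI
        exact hpt x hxI hx
    _ = α * (∫ x in Icc (-L) L, cv J W x) + c3 * ((∫ x in Icc (-L) L, |f x|) + ∫ x in Icc (-L) L, |g x|) +
        c4 * (2 * L + ∫ x in Icc (-L) L, |f x|) := by
        rw [integral_add i1 i8, hYint, integral_add i2 i7, integral_add i3 i6, integral_const_mul,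
          integral_const_mul, integral_const_mul,
          integral_add hfi.abs.integrableOn hgi.abs.integrableOn,
          integral_add i5 hfi.abs.integrableOn, setIntegral_const, vol_Icc hR, smul_eq_mul]
        ring
    _ ≤ _ := by
        have a1 : ∫ x in Icc (-L) L, cv J W x ≤ M := by
          refine le_trans ?_ hM
          rw [← cv_integral hJ hm hWi]
          exact setIntegral_le_integral hcv (Eventually.of_forall fun x => cv_nonneg h0 hW0 x)
        have a2 := (setInt_abs_le hfi (Icc (-L) L)).trans hGu
        have a3 := (setInt_abs_le hgi (Icc (-L) L)).trans hGv
        gcongr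
        linarith

end RegSol

namespace RegSol
open Set Topology
variable {J : ℝ → ℝ} {q α μ : ℝ}

/-- closing the row estimate -/
lemma row_arith {α M μ A L G C C0 S0 Du Dv η0 R1 Ru Rv : ℝ} (hμ : 0 < μ) (hα : 0 < α) (hA : 0 ≤ A)
    (hL : 1 ≤ L) (hG : 0 ≤ G) (hC : 0 ≤ C) (hC0 : 0 ≤ C0) (hS0 : 0 ≤ S0) (hDu : 0 ≤ Du) (hDv : 0 ≤ Dv)
    (hη : η0 = 2 * (2 * A * G + C0 * (2 + G) / (2 * μ)) / μ) (hLP : 2 * (2 * C * A * G) / μ ≤ L)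
    (h1 : R1 ≤ α * M + (μ * (A / L) + A / L * (2 + (S0 + Du + Dv))) * (2 * G)
        + C0 * (1 / L ^ 2) / (2 * μ) * (1 + (S0 + Du + Dv)) * (2 * L + G))
    (hu : Ru ≤ - (μ * Du) + (μ * (A / L) * C + C * (A / L) * (2 + (S0 + Du + Dv))) * G + α * C * (2 * G))
    (hv : Rv ≤ - (μ * Dv) + (μ * (A / L) * C + C * (A / L) * (2 + (S0 + Du + Dv))) * G + α * C * (2 * G)) :
    R1 + η0 / L * (Ru + Rv) ≤ α * M + ((2 * A * G + C0 * (2 + G) / (2 * μ)) * (2 + S0) + 2 * A * G * μ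
      + η0 * (2 * C * A * G * (2 + S0) + (2 * μ * A * C * G + 4 * α * C * G))) / L := by
  set P1 := 2 * A * G + C0 * (2 + G) / (2 * μ) with hP1
  set P2 := 2 * C * A * G with hP2
  set P3 := 2 * μ * A * C * G + 4 * α * C * G with hP3
  have hL0 : 0 < L := by linarith
  have hP10 : 0 ≤ P1 := by positivity
  have hP20 : 0 ≤ P2 := by positivity
  have hP30 : 0 ≤ P3 := by positivity
  have hη0 : 0 ≤ η0 := by rw [hη]; positivity
  obtain ⟨D, hD⟩ : ∃ D, D = Du + Dv := ⟨_, rfl⟩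
  have hD0 : 0 ≤ D := by rw [hD]; positivity
  have eS : S0 + Du + Dv = S0 + D := by rw [hD]; ring
  rw [eS] at h1 hu hv
  obtain ⟨i, hi⟩ : ∃ i, i = 1 / L := ⟨_, rfl⟩
  have hi0 : 0 < i := by rw [hi]; positivity
  have hi1 : i ≤ 1 := by rw [hi, div_le_one hL0]; exact hL
  have hiL : i * L = 1 := by rw [hi]; field_simp
  have eA : A / L = A * i := by rw [hi]; ring
  have eL2 : 1 / L ^ 2 = i ^ 2 := by rw [hi]; ring
  rw [eA] at h1 hu hv
  rw [eL2] at h1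
  have eη : η0 / L = η0 * i := by rw [hi]; ring
  rw [eη, div_eq_mul_one_div _ L, ← hi]
  -- first row
  have b1 : C0 * i ^ 2 / (2 * μ) * (1 + (S0 + D)) * (2 * L + G) ≤
      C0 * (2 + G) / (2 * μ) * (2 + (S0 + D)) * i := by
    have e1 : i ^ 2 * (2 * L + G) ≤ (2 + G) * i := by
      have : i ^ 2 * (2 * L + G) = 2 * i * (i * L) + i * (i * G) := by ring
      rw [this, hiL]
      have : i * (i * G) ≤ i * (1 * G) := by gcongr
      linarith
    calc _ = C0 / (2 * μ) * (1 + (S0 + D)) * (i ^ 2 * (2 * L + G)) := by ring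
      _ ≤ C0 / (2 * μ) * (2 + (S0 + D)) * ((2 + G) * i) := by
          gcongr
          norm_num
      _ = _ := by ring
  have r1 : R1 ≤ α * M + (P1 * (2 + (S0 + D)) + 2 * A * G * μ) * i := by
    rw [hP1]; linarith
  -- second rows
  have r2 : Ru + Rv ≤ - (μ * D) + P2 * i * (2 + (S0 + D)) + P3 := by
    have : μ * A * C * G * i ≤ μ * A * C * G * 1 := by gcongr
    rw [hP2, hP3, hD] at *
    linarith
  have k1 : P2 * i ≤ μ / 2 := by
    rw [div_le_iff₀ hμ] at hLP
    have : 2 * P2 * i ≤ L * μ * i := by gcongr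
    have : L * μ * i = μ * (i * L) := by ring
    rw [hiL] at this
    linarith
  have k2 : P2 * i ≤ P2 := mul_le_of_le_one_right hP20 hi1
  have hημ : η0 * μ = 2 * P1 := by rw [hη]; field_simp
  have r3 : Ru + Rv ≤ - (μ / 2 * D) + P2 * (2 + S0) + P3 := by
    have := mul_le_mul_of_nonneg_right k1 hD0
    have := mul_le_mul_of_nonneg_right k2 (by linarith : 0 ≤ 2 + S0)
    linarith
  have r4 := mul_le_mul_of_nonneg_left r3 (by positivity : 0 ≤ η0 * i)
  have r5 : η0 * i * (- (μ / 2 * D) + P2 * (2 + S0) + P3)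
      = (- (P1 * D) + η0 * (P2 * (2 + S0) + P3)) * i := by
    linear_combination (- (D * i) / 2) * hημ
  rw [r5] at r4
  linarith

set_option maxHeartbeats 1000000 in
lemma step {u v : ℝ → ℝ → ℝ} (hu : Sol J q α μ u) (hv : Sol J q α μ v)
    (h0 : ∀ x, 0 ≤ J x) (hJ : Integrable J)
    (hm : ∫ x, J x = 1) (hq1 : 1 < q) (hq2 : q < 2) (hα : 0 < α) (hμ : 0 < μ)
    {t1 t2 M : ℝ} (ht1 : 0 < t1) (h12 : t1 ≤ t2)
    (hM : ∀ s ∈ Icc t1 t2, ∫ x, max (u s x - v s x) 0 ≤ M) :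
    ∃ (j : ℕ) (Kc L0 : ℝ), ∀ L, 1 ≤ L → L0 ≤ L →
      ∫ x in Icc (-L) L, ps j L x * max (u t2 x - v t2 x) 0 ≤
        (∫ x, max (u t1 x - v t1 x) 0) + α * M * (t2 - t1) + Kc / L := by
  obtain ⟨j, A, hA, hcut⟩ := exists_cut hq1 hq2
  obtain ⟨C, hC0, hC⟩ := B1_bound (a := q / 4) (by linarith)
  obtain ⟨C0, hC00, hbeta⟩ := exists_beta
  obtain ⟨Gu, hGu0, hGu⟩ := hu.bound t2
  obtain ⟨Gv, hGv0, hGv⟩ := hv.bound t2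
  obtain ⟨G, hG0, hGu', hGv'⟩ : ∃ G, 0 ≤ G ∧ Gu ≤ G ∧ Gv ≤ G :=
    ⟨max Gu Gv, hGu0.trans (le_max_left _ _), le_max_left _ _, le_max_right _ _⟩
  set η0 := 2 * (2 * A * G + C0 * (2 + G) / (2 * μ)) / μ with hη
  have hη0 : 0 ≤ η0 := by rw [hη]; positivity
  set S0 := (A + 1) * G with hS0
  have hS00 : 0 ≤ S0 := by positivity
  set Q := (2 * A * G + C0 * (2 + G) / (2 * μ)) * (2 + S0) + 2 * A * G * μ
      + η0 * (2 * C * A * G * (2 + S0) + (2 * μ * A * C * G + 4 * α * C * G)) with hQ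
  refine ⟨j, Q * (t2 - t1) + 2 + η0 * C * (4 * G), 2 * (2 * C * A * G) / μ, fun L hL hLP => ?_⟩
  have hL0 : 0 < L := by linarith
  have K := hcut L hL
  set ψ := ps j L with hψ
  set ψ1 := ps1 j L
  set ψ2 := ps2 j L
  have hδ : 0 < 1 / L ^ 2 := by positivity
  have hδ1 : 1 / L ^ 2 ≤ 1 := by
    rw [div_le_one (by positivity)]; exact one_le_pow₀ hL
  obtain ⟨β, p, r, B⟩ := hbeta (1 / L ^ 2) hδ
  set η := η0 / L with hηd
  have hηn : 0 ≤ η := by positivity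
  set a := q / 4 with ha
  have B0d : ∀ z, HasDerivAt (B0 a) (B1 a z) z := fun z => Prim_hasDerivAt (B1_cont a) z
  have B0c : Continuous (B0 a) := Prim_continuous (B1_cont a)
  have k0 := K.c0
  have hsub : ∀ s ∈ Icc t1 t2, 0 < s := fun s hs => ht1.trans_le hs.1
  have hGus : ∀ s ∈ Icc t1 t2, ∫ x, |u s x| ≤ G := fun s hs =>
    (hGu s ⟨(hsub s hs).le, hs.2⟩).trans hGu'
  have hGvs : ∀ s ∈ Icc t1 t2, ∫ x, |v s x| ≤ G := fun s hs =>
    (hGv s ⟨(hsub s hs).le, hs.2⟩).trans hGv'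
  set b : ℝ → ℝ → ℝ := fun s x => ψ x * (β (u s x - v s x) + η * (B0 a (u s x) + B0 a (v s x))) with hb
  set db : ℝ → ℝ → ℝ := fun s x => ψ x * (p (u s x - v s x) * (dt u s x - dt v s x)
    + η * (B1 a (u s x) * dt u s x + B1 a (v s x) * dt v s x)) with hdb
  have hcls : Cls (fun s t x => |u s x - u t x| + |v s x - v t x|) (fun s x => |dt u s x| + |dt v s x|)
      L t1 t2 (α * M + Q / L) b db := by
    refine ⟨fun s hs x => ?_, fun x => ?_, fun s hs => ?_, ?_, fun s hs => ?_⟩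
    · have du := hu.hasDt hs x
      have dv := hv.hasDt hs x
      exact (((B.hβ (u s x - v s x)).comp s (du.sub dv)).add
        ((((B0d (u s x)).comp s du).add ((B0d (v s x)).comp s dv)).const_mul η)).const_mul (ψ x)
    · have a1 := hu.t_cont x
      have a2 := hv.t_cont x
      have a3 := hu.dt_cont x
      have a4 := hv.dt_cont x
      exact continuousOn_const.mul (((B.pc.comp_continuousOn (a1.sub a2)).mul (a3.sub a4)).add
        (continuousOn_const.mul ((((B1_cont a).comp_continuousOn a1).mul a3).add
          (((B1_cont a).comp_continuousOn a2).mul a4))))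
    · have a1 := c2_c0 (hu.c2 s hs)
      have a2 := c2_c0 (hv.c2 s hs)
      exact k0.mul ((B.βc.comp (a1.sub a2)).add (continuous_const.mul ((B0c.comp a1).add (B0c.comp a2))))
    · refine ⟨1 + η * C, by positivity, fun s hs t ht x hx => ?_, fun s hs x hx => ?_⟩
      · have e1 : b s x - b t x = ψ x * ((β (u s x - v s x) - β (u t x - v t x))
            + η * ((B0 a (u s x) - B0 a (u t x)) + (B0 a (v s x) - B0 a (v t x)))) := by
          simp only [hb]; ring
        rw [e1, abs_mul, abs_of_nonneg (K.nn x hx)]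
        have l1 := B.lip (u s x - v s x) (u t x - v t x)
        have l1' : |u s x - v s x - (u t x - v t x)| ≤ |u s x - u t x| + |v s x - v t x| := by
          have : u s x - v s x - (u t x - v t x) = (u s x - u t x) - (v s x - v t x) := by ring
          rw [this]; exact abs_sub _ _
        have l2 := lip_of_deriv B0d hC (u s x) (u t x)
        have l3 := lip_of_deriv B0d hC (v s x) (v t x)
        have l4 := abs_add_le (B0 a (u s x) - B0 a (u t x)) (B0 a (v s x) - B0 a (v t x))
        have l5 := abs_add_le (β (u s x - v s x) - β (u t x - v t x))
          (η * ((B0 a (u s x) - B0 a (u t x)) + (B0 a (v s x) - B0 a (v t x))))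
        rw [abs_mul η, abs_of_nonneg hηn] at l5
        have l6 := mul_le_mul_of_nonneg_left (by linarith : |B0 a (u s x) - B0 a (u t x) +
          (B0 a (v s x) - B0 a (v t x))| ≤ C * (|u s x - u t x| + |v s x - v t x|)) hηn
        have l7 : 0 ≤ (1 + η * C) * |s - t| := by positivity
        exact pmul_le (K.nn x hx) (K.le x hx) (by linarith) (by positivity)
      · simp only [hdb]
        rw [abs_mul, abs_of_nonneg (K.nn x hx)]
        refine pmul_le (K.nn x hx) (K.le x hx) ?_ (by positivity)
        have l1 : |p (u s x - v s x) * (dt u s x - dt v s x)| ≤ |dt u s x| + |dt v s x| := by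
          rw [abs_mul, abs_of_nonneg (B.p0 _)]
          exact pmul_le (B.p0 _) (B.p1 _) (abs_sub _ _) (by positivity)
        have l2 : |B1 a (u s x) * dt u s x| ≤ C * |dt u s x| := by
          rw [abs_mul]; gcongr; exact hC _
        have l3 : |B1 a (v s x) * dt v s x| ≤ C * |dt v s x| := by
          rw [abs_mul]; gcongr; exact hC _
        have l4 := abs_add_le (B1 a (u s x) * dt u s x) (B1 a (v s x) * dt v s x)
        have l5 := abs_add_le (p (u s x - v s x) * (dt u s x - dt v s x))
          (η * (B1 a (u s x) * dt u s x + B1 a (v s x) * dt v s x))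
        rw [abs_mul η, abs_of_nonneg hηn] at l5
        have l6 := mul_le_mul_of_nonneg_left (by linarith : |B1 a (u s x) * dt u s x +
          B1 a (v s x) * dt v s x| ≤ C * (|dt u s x| + |dt v s x|)) hηn
        have l7 : 0 ≤ η * C := by positivity
        linarith
    · have hs0 := hsub s hs
      have Du0 := Dis_nonneg K (u s)
      have Dv0 := Dis_nonneg K (v s)
      have su := s_bound hq1 hq2 K hL hA (hu.c2 s hs0) (hu.int s hs0.le) (hGus s hs)
      have sv := s_bound hq1 hq2 K hL hA (hv.c2 s hs0) (hv.int s hs0.le) (hGvs s hs)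
      have su' : ∀ x ∈ Icc (-L) L, ψ x * QQ (q / 4) (u s x) ≤ S0 + Dis q L ψ (u s) + Dis q L ψ (v s) :=
        fun x hx => (su x hx).trans (by linarith)
      have sv' : ∀ x ∈ Icc (-L) L, ψ x * QQ (q / 4) (v s x) ≤ S0 + Dis q L ψ (u s) + Dis q L ψ (v s) :=
        fun x hx => (sv x hx).trans (by linarith)
      have hSn : 0 ≤ S0 + Dis q L ψ (u s) + Dis q L ψ (v s) := by positivity
      obtain ⟨i1, r1⟩ := row1 hu hv h0 hJ hm hq1 hq2 hα hμ hs0 K hL hA hδ hδ1 hC00 B (hGus s hs)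
        (hGvs s hs) (hM s hs) su' sv' hSn
      obtain ⟨i2, r2⟩ := row2 hu h0 hJ hm hq1 hq2 hα hμ hs0 K hL hA (hGus s hs) hC0 hC su' hSn
      obtain ⟨i3, r3⟩ := row2 hv h0 hJ hm hq1 hq2 hα hμ hs0 K hL hA (hGvs s hs) hC0 hC sv' hSn
      have := row_arith hμ hα hA hL hG0 hC0 hC00 hS00 Du0 Dv0 hη hLP r1 r2 r3
      refine le_trans (le_of_eq ?_) this
      have i4 : IntegrableOn (fun x => η0 / L * (ψ x * (B1 (q/4) (u s x) * dt u s x)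
          + ψ x * (B1 (q/4) (v s x) * dt v s x))) (Icc (-L) L) := (i2.add i3).const_mul _
      rw [← integral_add i2 i3, ← integral_const_mul, ← integral_add i1 i4]
      refine integral_congr_ae (Eventually.of_forall fun x => ?_)
      simp only [hdb, Pi.add_apply]
      ring
  have hmain := pp_holds hu hv h0 hJ hm hq1 hα hμ hL0.le ht1 h12 b db _ hcls
  have ht2 : 0 < t2 := ht1.trans_le h12
  have hiu : ∀ s ∈ Icc t1 t2, Integrable (u s) := fun s hs => hu.int s (hsub s hs).le
  have hiv : ∀ s ∈ Icc t1 t2, Integrable (v s) := fun s hs => hv.int s (hsub s hs).le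
  have hsum : ∀ s ∈ Icc t1 t2, ∫ x in Icc (-L) L, η * C * (|u s x| + |v s x|) ≤ η * C * (2 * G) := by
    intro s hs
    rw [integral_const_mul, integral_add (hiu s hs).abs.integrableOn (hiv s hs).abs.integrableOn]
    have a1 := (setInt_abs_le (hiu s hs) (Icc (-L) L)).trans (hGus s hs)
    have a2 := (setInt_abs_le (hiv s hs) (Icc (-L) L)).trans (hGvs s hs)
    gcongr
    linarith
  have hBs : ∀ s x, x ∈ Icc (-L) L → |ψ x * (η * (B0 a (u s x) + B0 a (v s x)))| ≤ η * C * (|u s x| + |v s x|) := by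
    intro s x hx
    rw [abs_mul, abs_of_nonneg (K.nn x hx)]
    refine pmul_le (K.nn x hx) (K.le x hx) ?_ (by positivity)
    rw [abs_mul, abs_of_nonneg hηn]
    have l2 := B0_bound hC (u s x)
    have l3 := B0_bound hC (v s x)
    have l4 := abs_add_le (B0 a (u s x)) (B0 a (v s x))
    have := mul_le_mul_of_nonneg_left (by linarith : |B0 a (u s x) + B0 a (v s x)| ≤
      C * (|u s x| + |v s x|)) hηn
    linarith
  have m1 : t1 ∈ Icc t1 t2 := ⟨le_rfl, h12⟩
  have m2 : t2 ∈ Icc t1 t2 := ⟨h12, le_rfl⟩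
  have hbi : ∀ s ∈ Icc t1 t2, IntegrableOn (b s) (Icc (-L) L) := fun s hs =>
    (hcls.hx s (hsub s hs)).integrableOn_Icc
  have hsi : ∀ s ∈ Icc t1 t2, IntegrableOn (fun x => η * C * (|u s x| + |v s x|)) (Icc (-L) L) :=
    fun s hs => (((hiu s hs).abs.add (hiv s hs).abs).const_mul _).integrableOn
  have hW : ∀ s ∈ Icc t1 t2, Integrable (fun x => max (u s x - v s x) 0) := fun s hs =>
    ((hiu s hs).sub (hiv s hs)).pos_part
  -- upper bound at t1
  have up : ∫ x in Icc (-L) L, b t1 x ≤ (∫ x, max (u t1 x - v t1 x) 0) + η * C * (2 * G) := by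
    calc _ ≤ ∫ x in Icc (-L) L, (max (u t1 x - v t1 x) 0 + η * C * (|u t1 x| + |v t1 x|)) := by
          refine setIntegral_mono_on (hbi t1 m1) ((hW t1 m1).integrableOn.add (hsi t1 m1))
            measurableSet_Icc (fun x hx => ?_)
          have a1 := (le_abs_self _).trans (hBs t1 x hx)
          have a2 := pmul_le (K.nn x hx) (K.le x hx) (B.β1 (u t1 x - v t1 x)) (le_max_right _ _)
          simp only [hb]
          linarith
      _ = (∫ x in Icc (-L) L, max (u t1 x - v t1 x) 0) + ∫ x in Icc (-L) L, η * C * (|u t1 x| + |v t1 x|) :=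
          integral_add (hW t1 m1).integrableOn (hsi t1 m1)
      _ ≤ _ := add_le_add (setIntegral_le_integral (hW t1 m1)
          (Eventually.of_forall fun x => le_max_right _ _)) (hsum t1 m1)
  -- lower bound at t2
  have low : ∫ x in Icc (-L) L, ψ x * max (u t2 x - v t2 x) 0 ≤
      (∫ x in Icc (-L) L, b t2 x) + η * C * (2 * G) + 2 / L := by
    have c1 := c2_c0 (hu.c2 t2 ht2)
    have c2 := c2_c0 (hv.c2 t2 ht2)
    have ic : IntegrableOn (fun _ : ℝ => 1 / L ^ 2) (Icc (-L) L) := integrableOn_const (by simp)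
    have i5 : IntegrableOn (fun x => b t2 x + η * C * (|u t2 x| + |v t2 x|)) (Icc (-L) L) :=
      (hbi t2 m2).add (hsi t2 m2)
    calc _ ≤ ∫ x in Icc (-L) L, (b t2 x + η * C * (|u t2 x| + |v t2 x|) + 1 / L ^ 2) := by
          refine setIntegral_mono_on (Continuous.integrableOn_Icc (by fun_prop)) (i5.add ic)
            measurableSet_Icc (fun x hx => ?_)
          have a1 := (neg_le_abs _).trans (hBs t2 x hx)
          have a3 : max (u t2 x - v t2 x) 0 - β (u t2 x - v t2 x) ≤ 1 / L ^ 2 := by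
            have := B.β2 (u t2 x - v t2 x)
            have := B.β0 (u t2 x - v t2 x)
            rcases max_cases (u t2 x - v t2 x) 0 with h | h <;> linarith
          have a2 := pmul_le (K.nn x hx) (K.le x hx) a3 hδ.le
          simp only [hb]
          linarith
      _ = (∫ x in Icc (-L) L, b t2 x) + (∫ x in Icc (-L) L, η * C * (|u t2 x| + |v t2 x|)) + 2 / L := by
          rw [integral_add i5 ic, integral_add (hbi t2 m2) (hsi t2 m2), setIntegral_const, vol_Icc hL0.le,
            smul_eq_mul]
          congr 1
          field_simp
      _ ≤ _ := by
          have := hsum t2 m2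
          linarith
  have hfin : (Q * (t2 - t1) + 2 + η0 * C * (4 * G)) / L =
      Q / L * (t2 - t1) + 2 / L + η * C * (4 * G) := by rw [hηd]; ring
  rw [hfin]
  linarith

end RegSol

namespace RegSol
open Set Topology
variable {J : ℝ → ℝ} {q α μ : ℝ}

lemma ps_limit (j : ℕ) {w : ℝ → ℝ} (hw : Integrable w) (h0 : ∀ x, 0 ≤ w x) :
    Tendsto (fun L : ℝ => ∫ x in Icc (-L) L, ps j L x * w x) atTop (𝓝 (∫ x, w x)) := by
  have e : ∀ L : ℝ, ∫ x in Icc (-L) L, ps j L x * w x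
      = ∫ x, (Icc (-L) L).indicator (fun x => ps j L x * w x) x := fun L =>
    (integral_indicator measurableSet_Icc).symm
  simp only [e]
  refine tendsto_integral_filter_of_dominated_convergence w ?_ ?_ hw ?_
  · refine Eventually.of_forall fun L => AEStronglyMeasurable.indicator ?_ measurableSet_Icc
    refine AEStronglyMeasurable.mul ?_ hw.1
    refine Continuous.aestronglyMeasurable ?_
    unfold ps om
    fun_prop
  · filter_upwards [eventually_ge_atTop (1:ℝ)] with L hL
    refine Eventually.of_forall fun x => ?_
    by_cases hx : x ∈ Icc (-L) L
    · rw [indicator_of_mem hx]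
      obtain ⟨o0, o1⟩ := om_mem hL hx
      have p0 : 0 ≤ ps j L x := pow_nonneg o0 _
      have p1 : ps j L x ≤ 1 := pow_le_one₀ o0 o1
      rw [Real.norm_of_nonneg (mul_nonneg p0 (h0 x))]
      exact mul_le_of_le_one_left (h0 x) p1
    · rw [indicator_of_notMem hx]; simpa using h0 x
  · refine Eventually.of_forall fun x => ?_
    have h1 : Tendsto (fun L => ps j L x * w x) atTop (𝓝 (w x)) := by
      simpa using (ps_tendsto j x).mul_const (w x)
    refine h1.congr' ?_
    filter_upwards [eventually_ge_atTop |x|] with L hL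
    have hx : x ∈ Icc (-L) L := abs_le.1 hL
    rw [indicator_of_mem hx]

lemma step2 {u v : ℝ → ℝ → ℝ} (hu : Sol J q α μ u) (hv : Sol J q α μ v)
    (h0 : ∀ x, 0 ≤ J x) (hJ : Integrable J)
    (hm : ∫ x, J x = 1) (hq1 : 1 < q) (hq2 : q < 2) (hα : 0 < α) (hμ : 0 < μ)
    {t1 t2 M : ℝ} (ht1 : 0 < t1) (h12 : t1 ≤ t2)
    (hM : ∀ s ∈ Icc t1 t2, ∫ x, max (u s x - v s x) 0 ≤ M) :
    ∫ x, max (u t2 x - v t2 x) 0 ≤ (∫ x, max (u t1 x - v t1 x) 0) + α * M * (t2 - t1) := by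
  obtain ⟨j, Kc, L0, h⟩ := step hu hv h0 hJ hm hq1 hq2 hα hμ ht1 h12 hM
  have ht2 : 0 ≤ t2 := (ht1.trans_le h12).le
  have l1 := ps_limit j (w := fun x => max (u t2 x - v t2 x) 0)
    (((hu.int t2 ht2).sub (hv.int t2 ht2)).pos_part) (fun x => le_max_right _ _)
  have l2 : Tendsto (fun L : ℝ => Kc / L) atTop (𝓝 0) := tendsto_const_nhds.div_atTop tendsto_id
  have l3 := l2.const_add ((∫ x, max (u t1 x - v t1 x) 0) + α * M * (t2 - t1))
  rw [add_zero] at l3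
  refine le_of_tendsto_of_tendsto l1 l3 ?_
  filter_upwards [eventually_ge_atTop (1:ℝ), eventually_ge_atTop L0] with L a b
  exact h L a b

lemma m_cont {u v : ℝ → ℝ → ℝ} (hu : Sol J q α μ u) (hv : Sol J q α μ v) :
    ContinuousOn (fun t => ∫ x, max (u t x - v t x) 0) (Ici 0) := by
  intro t ht
  rw [ContinuousWithinAt, tendsto_iff_norm_sub_tendsto_zero]
  have hs := (hu.con t ht).add (hv.con t ht)
  rw [add_zero] at hs
  refine squeeze_zero' (Eventually.of_forall fun _ => norm_nonneg _) ?_ hs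
  filter_upwards [self_mem_nhdsWithin] with s hs
  have iu := (hu.int s hs).sub (hu.int t ht)
  have iv := (hv.int s hs).sub (hv.int t ht)
  have i1 : Integrable (fun x => |u s x - u t x|) := iu.abs
  have i2 : Integrable (fun x => |v s x - v t x|) := iv.abs
  have p1 : Integrable (fun x => max (u s x - v s x) 0) := ((hu.int s hs).sub (hv.int s hs)).pos_part
  have p2 : Integrable (fun x => max (u t x - v t x) 0) := ((hu.int t ht).sub (hv.int t ht)).pos_part
  rw [← integral_sub p1 p2, ← integral_add i1 i2]
  refine (norm_integral_le_integral_norm _).trans ?_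
  refine integral_mono (p1.sub p2).norm (i1.add i2) (fun x => ?_)
  have a1 : |max (u s x - v s x) 0 - max (u t x - v t x) 0| ≤ |(u s x - v s x) - (u t x - v t x)| :=
    abs_max_sub_max_le_abs _ _ _
  have a2 : |(u s x - v s x) - (u t x - v t x)| ≤ |u s x - u t x| + |v s x - v t x| := by
    have : (u s x - v s x) - (u t x - v t x) = (u s x - u t x) - (v s x - v t x) := by ring
    rw [this]; exact abs_sub _ _
  exact a1.trans a2

lemma gron {m : ℝ → ℝ} {α : ℝ} (hα : 0 < α) (hc : ContinuousOn m (Ici 0)) (hn : ∀ t, 0 ≤ m t)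
    (hz : m 0 = 0)
    (hs : ∀ t1 t2 M, 0 < t1 → t1 ≤ t2 → (∀ s ∈ Icc t1 t2, m s ≤ M) →
      m t2 ≤ m t1 + α * M * (t2 - t1)) : ∀ t, 0 ≤ t → m t = 0 := by
  have key : ∀ T : ℝ, 0 ≤ T → m T = 0 → ∀ t ∈ Icc T (T + 1 / (2 * α)), m t = 0 := by
    intro T hT hmT
    have hh : 0 < 1 / (2 * α) := by positivity
    have hc' : ContinuousOn m (Icc T (T + 1 / (2 * α))) := hc.mono fun s hs => hT.trans hs.1
    obtain ⟨z, hz1, hz2⟩ := isCompact_Icc.exists_isMaxOn (nonempty_Icc.2 (by linarith)) hc'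
    have hzM : ∀ s ∈ Icc T (T + 1 / (2 * α)), m s ≤ m z := fun s hs => hz2 hs
    have hmz : m z ≤ 0 := by
      rcases eq_or_lt_of_le hz1.1 with h | h
      · rw [← h, hmT]
      have l1 : Tendsto m (𝓝[>] T) (𝓝 0) := by
        rw [← hmT]
        exact (hc T hT).mono_left (nhdsWithin_mono _ fun s hs => hT.trans (le_of_lt hs))
      have l2 : Tendsto (fun s => m s + α * m z * (1 / (2 * α))) (𝓝[>] T)
          (𝓝 (0 + α * m z * (1 / (2 * α)))) := l1.add_const _
      have : m z ≤ 0 + α * m z * (1 / (2 * α)) := by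
        refine ge_of_tendsto l2 ?_
        filter_upwards [Ioc_mem_nhdsGT h] with s hs'
        have := hs s z (m z) (hT.trans_lt hs'.1) hs'.2
          (fun r hr => hzM r ⟨hs'.1.le.trans hr.1, hr.2.trans hz1.2⟩)
        have h3 : α * m z * (z - s) ≤ α * m z * (1 / (2 * α)) := by
          have := hn z
          have := hz1.2
          have := hs'.1
          gcongr
          linarith
        linarith
      have e : α * m z * (1 / (2 * α)) = m z / 2 := by field_simp
      linarith
    intro t ht
    exact le_antisymm ((hzM t ht).trans hmz) (hn t)
  have ind : ∀ n : ℕ, ∀ t ∈ Icc 0 ((n:ℝ) * (1 / (2 * α))), m t = 0 := by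
    intro n
    induction n with
    | zero => 
      intro t ht
      have : t = 0 := le_antisymm (by simpa using ht.2) ht.1
      rw [this, hz]
    | succ n ih =>
      intro t ht
      have hn0 : 0 ≤ (n:ℝ) * (1 / (2 * α)) := by positivity
      rcases le_total t ((n:ℝ) * (1 / (2 * α))) with h | h
      · exact ih t ⟨ht.1, h⟩
      · refine key _ hn0 (ih _ ⟨hn0, le_rfl⟩) t ⟨h, ?_⟩
        have := ht.2
        push_cast at this
        linarith
  intro t ht
  obtain ⟨n, hn'⟩ := exists_nat_ge (t * (2 * α))
  refine ind n t ⟨ht, ?_⟩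
  rw [mul_one_div, le_div_iff₀ (by positivity)]
  exact hn'

lemma final {u v : ℝ → ℝ → ℝ} (hu : Sol J q α μ u) (hv : Sol J q α μ v)
    (h0 : ∀ x, 0 ≤ J x) (hJ : Integrable J)
    (hm : ∫ x, J x = 1) (hq1 : 1 < q) (hq2 : q < 2) (hα : 0 < α) (hμ : 0 < μ)
    (hi : ∀ᵐ x, u 0 x ≤ v 0 x) {t : ℝ} (ht : 0 ≤ t) : ∀ᵐ x, u t x ≤ v t x := by
  have hz : ∫ x, max (u 0 x - v 0 x) 0 = 0 := by
    refine integral_eq_zero_of_ae ?_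
    filter_upwards [hi] with x hx
    exact max_eq_right (by linarith)
  have h := gron hα (m_cont hu hv) (fun t => integral_nonneg fun x => le_max_right _ _) hz
    (fun t1 t2 M a b c => step2 hu hv h0 hJ hm hq1 hq2 hα hμ a b c) t ht
  have p1 : Integrable (fun x => max (u t x - v t x) 0) := ((hu.int t ht).sub (hv.int t ht)).pos_part
  have p0 : (0 : ℝ → ℝ) ≤ fun x => max (u t x - v t x) 0 := fun x => le_max_right _ _
  have h := (integral_eq_zero_iff_of_nonneg p0 p1).1 h
  filter_upwards [h] with x hx
  have : max (u t x - v t x) 0 = 0 := hx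
  have := le_max_left (u t x - v t x) 0
  linarith

end RegSol

theorem stmt8
    (J : ℝ → ℝ) (hJpos : ∀ x, 0 ≤ J x) (hJeven : ∀ x, J (-x) = J x)
    (hJint : Integrable J) (hJmass : ∫ x, J x = 1)
    (q : ℝ) (hq1 : 1 < q) (hq2 : q < 2)
    (α μ : ℝ) (hα : 0 < α) (hμ : 0 < μ)
    (φ φt : ℝ → ℝ) (hφ : Integrable φ) (hφt : Integrable φt)
    (hle : ∀ᵐ x ∂(volume : Measure ℝ), φ x ≤ φt x)
    (u ut : ℝ → ℝ → ℝ)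
    (hu : IsRegSol J q α μ φ u) (hut : IsRegSol J q α μ φt ut) :
    ∀ t : ℝ, 0 < t → ∀ᵐ x ∂(volume : Measure ℝ), u t x ≤ ut t x := by
  obtain ⟨a1, a2, a3, a4, a5, a6⟩ := hu
  obtain ⟨b1, b2, b3, b4, b5, b6⟩ := hut
  have hU : RegSol.Sol J q α μ u := ⟨a1, a2, a3, a4, fun t ht x => by
    have := a5 t ht x
    unfold RegSol.dt RegSol.cv
    linarith⟩
  have hV : RegSol.Sol J q α μ ut := ⟨b1, b2, b3, b4, fun t ht x => by
    have := b5 t ht x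
    unfold RegSol.dt RegSol.cv
    linarith⟩
  intro t ht
  refine RegSol.final hU hV hJpos hJint hJmass hq1 hq2 hα hμ ?_ ht.le
  filter_upwards [hle, a6, b6] with x h1 h2 h3
  rw [h2, h3]
  exact h1
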